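/- arXiv:math/0405033 — 8 statements merged into one kernel-verified Lean document; each statement's English description precedes it below -/
import Mathlib

section
/- For every integer n ≥ 2, among all vectors a = (a₀, a₁, …, a_n) ∈ ℝ^{n+1} satisfying the two linear constraints a₀ + 2·Σ_{j=1}^{n} a_j = 1 and Σ_{j=1}^{n} j² a_j = −1/6, the function ν(a) = |a₀| + 2·Σ_{j=1}^{n} |a_j| attains its minimum at the unique point a* given by a₀* = 1 + 1/(3n²), a_n* = −1/(6n²), and a_j* = 0 for 1 ≤ j ≤ n−1; the minimal value is ν(a*) = 1 + 2/(3n²). -/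
open Finset

/-- The ℓ¹-type functional `ν(a) = |a₀| + 2 Σ_{j=1}^n |a_j|` bounding the
infinite norm of the symmetric discrete quasi-interpolant. -/
noncomputable def nuNorm (n : ℕ) (a : Fin (n + 1) → ℝ) : ℝ :=
  |a 0| + 2 * ∑ j ∈ Finset.univ.erase (0 : Fin (n + 1)), |a j|

/-- The optimal coefficient vector for the near-best cubic spline discrete
quasi-interpolant: `a₀* = 1 + 1/(3n²)`, `a_n* = −1/(6n²)`, `a_j* = 0`
for `1 ≤ j ≤ n−1`. -/
noncomputable def aStarD (n : ℕ) : Fin (n + 1) → ℝ := fun j =>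
  if j = 0 then 1 + 1 / (3 * (n : ℝ) ^ 2)
  else if (j : ℕ) = n then -(1 / (6 * (n : ℝ) ^ 2)) else 0

/-- A sum over nonzero indices of a function vanishing strictly between `0` and `n`
reduces to its last term. -/
lemma sum_erase_zero_eq_last {n : ℕ} (hn : n ≠ 0) (f : Fin (n + 1) → ℝ)
    (hf : ∀ j : Fin (n + 1), j ≠ 0 → (j : ℕ) ≠ n → f j = 0) :
    ∑ j ∈ Finset.univ.erase (0 : Fin (n + 1)), f j = f (Fin.last n) := by
  have hl : Fin.last n ≠ 0 := fun h => hn (by simpa using congrArg Fin.val h)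
  refine Finset.sum_eq_single_of_mem _ (by simp [hl]) fun j hj hjn => ?_
  exact hf j (Finset.ne_of_mem_erase hj) fun h => hjn (Fin.ext h)

/-- Multiplying by a factor of absolute value at most one does not exceed the absolute value. -/
lemma mul_le_abs_of_abs_le_one {c : ℝ} (hc : |c| ≤ 1) (x : ℝ) : c * x ≤ |x| :=
  calc c * x ≤ |c * x| := le_abs_self _
    _ = |c| * |x| := abs_mul c x
    _ ≤ |x| := mul_le_of_le_one_left (abs_nonneg x) hc

/-- If the factor has absolute value less than one, equality forces `x = 0`. -/
lemma eq_zero_of_abs_eq_mul {c x : ℝ} (hc : |c| < 1) (h : |x| = c * x) : x = 0 := by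
  by_contra hx
  have h1 : c * x ≤ |c| * |x| := (le_abs_self _).trans (abs_mul c x).le
  have h2 := mul_lt_of_lt_one_left (abs_pos.mpr hx) hc
  linarith

/-- The dual weights `1 - 2 j² / n²` express `ν` on the constraint set as the optimal value
plus the slacks. -/
lemma nuNorm_eq_add_slack {n : ℕ} (a : Fin (n + 1) → ℝ)
    (h1 : a 0 + 2 * ∑ j ∈ Finset.univ.erase (0 : Fin (n + 1)), a j = 1)
    (h2 : ∑ j ∈ Finset.univ.erase (0 : Fin (n + 1)),
      ((j : ℕ) : ℝ) ^ 2 * a j = -(1 / 6 : ℝ)) :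
    nuNorm n a = 1 + 2 / (3 * (n : ℝ) ^ 2) + (|a 0| - a 0) +
      2 * ∑ j ∈ Finset.univ.erase (0 : Fin (n + 1)),
        (|a j| - (1 - 2 * ((j : ℕ) : ℝ) ^ 2 / (n : ℝ) ^ 2) * a j) := by
  have h3 : ∑ j ∈ Finset.univ.erase (0 : Fin (n + 1)),
        (|a j| - (1 - 2 * ((j : ℕ) : ℝ) ^ 2 / (n : ℝ) ^ 2) * a j) =
      ∑ j ∈ Finset.univ.erase (0 : Fin (n + 1)), |a j| -
        ∑ j ∈ Finset.univ.erase (0 : Fin (n + 1)), a j +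
        2 / (n : ℝ) ^ 2 *
          ∑ j ∈ Finset.univ.erase (0 : Fin (n + 1)), ((j : ℕ) : ℝ) ^ 2 * a j := by
    rw [Finset.mul_sum, ← Finset.sum_sub_distrib, ← Finset.sum_add_distrib]
    exact Finset.sum_congr rfl fun j _ => by ring
  have h4 : (2 : ℝ) / (3 * (n : ℝ) ^ 2) = 2 / 3 * (1 / (n : ℝ) ^ 2) := by
    rw [div_mul_div_comm, mul_one]
  rw [h3, h2, h4, nuNorm]
  linear_combination h1

/-- **Near-best discrete cubic spline quasi-interpolants.**  For `n ≥ 2`,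
among all `a = (a₀,…,a_n)` with `a₀ + 2 Σ_{j=1}^n a_j = 1` and
`Σ_{j=1}^n j² a_j = −1/6`, the functional `ν(a) = |a₀| + 2 Σ_{j=1}^n |a_j|`
attains its minimum exactly at `a*`, with minimal value `ν(a*) = 1 + 2/(3n²)`. -/
theorem near_best_discrete_cubic_QI (n : ℕ) (hn : 2 ≤ n) :
    (aStarD n 0 + 2 * ∑ j ∈ Finset.univ.erase (0 : Fin (n + 1)), aStarD n j = 1) ∧
    (∑ j ∈ Finset.univ.erase (0 : Fin (n + 1)),
        ((j : ℕ) : ℝ) ^ 2 * aStarD n j = -(1 / 6 : ℝ)) ∧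
    nuNorm n (aStarD n) = 1 + 2 / (3 * (n : ℝ) ^ 2) ∧
    ∀ a : Fin (n + 1) → ℝ,
      (a 0 + 2 * ∑ j ∈ Finset.univ.erase (0 : Fin (n + 1)), a j = 1) →
      (∑ j ∈ Finset.univ.erase (0 : Fin (n + 1)), ((j : ℕ) : ℝ) ^ 2 * a j = -(1 / 6 : ℝ)) →
      nuNorm n (aStarD n) ≤ nuNorm n a ∧
        (nuNorm n a = nuNorm n (aStarD n) → a = aStarD n) := by
  have hn0 : n ≠ 0 := by omega
  have hnR : (n : ℝ) ≠ 0 := Nat.cast_ne_zero.mpr hn0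
  have hnpos : (0 : ℝ) < (n : ℝ) ^ 2 := by positivity
  have s0 : aStarD n 0 = 1 + 1 / (3 * (n : ℝ) ^ 2) := by simp [aStarD]
  have sl : aStarD n (Fin.last n) = -(1 / (6 * (n : ℝ) ^ 2)) := by simp [aStarD, hn0]
  have sm : ∀ j : Fin (n + 1), j ≠ 0 → (j : ℕ) ≠ n → aStarD n j = 0 := fun j h h' => by simp [aStarD, h, h']
  have value : nuNorm n (aStarD n) = 1 + 2 / (3 * (n : ℝ) ^ 2) := by
    rw [nuNorm, sum_erase_zero_eq_last hn0 _ fun j h h' => by rw [sm j h h', abs_zero],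
      s0, sl, abs_neg, abs_of_nonneg (by positivity), abs_of_nonneg (by positivity)]
    field_simp
    ring
  refine ⟨?_, ?_, value, fun a h1 h2 => ?_⟩
  · rw [sum_erase_zero_eq_last hn0 _ sm, s0, sl]
    field_simp
    ring
  · rw [sum_erase_zero_eq_last hn0 _ fun j h h' => by rw [sm j h h', mul_zero], sl, Fin.val_last]
    field_simp
  have key := nuNorm_eq_add_slack a h1 h2
  have slack_nonneg : ∀ j ∈ Finset.univ.erase (0 : Fin (n + 1)),
      0 ≤ |a j| - (1 - 2 * ((j : ℕ) : ℝ) ^ 2 / (n : ℝ) ^ 2) * a j := fun j _ => by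
    refine sub_nonneg.mpr (mul_le_abs_of_abs_le_one (abs_le.mpr ⟨?_, ?_⟩) _)
    · have hj : ((j : ℕ) : ℝ) ≤ n := Nat.cast_le.mpr (Nat.lt_succ_iff.mp j.isLt)
      have : 2 * ((j : ℕ) : ℝ) ^ 2 / (n : ℝ) ^ 2 ≤ 2 := by
        rw [div_le_iff₀ hnpos]
        gcongr
      linarith
    · have : 0 ≤ 2 * ((j : ℕ) : ℝ) ^ 2 / (n : ℝ) ^ 2 := by positivity
      linarith
  have slack_sum_nonneg := Finset.sum_nonneg slack_nonneg
  have a0_le := le_abs_self (a 0)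
  refine ⟨by linarith, fun heq => ?_⟩
  have slack_zero := (Finset.sum_eq_zero_iff_of_nonneg slack_nonneg).mp (by linarith)
  have am : ∀ j : Fin (n + 1), j ≠ 0 → (j : ℕ) ≠ n → a j = 0 := fun j h h' => by
    refine eq_zero_of_abs_eq_mul (abs_lt.mpr ⟨?_, ?_⟩)
      (sub_eq_zero.mp (slack_zero j (by simp [h])))
    · have hj : ((j : ℕ) : ℝ) < n :=
        Nat.cast_lt.mpr (lt_of_le_of_ne (Nat.lt_succ_iff.mp j.isLt) h')
      have : 2 * ((j : ℕ) : ℝ) ^ 2 / (n : ℝ) ^ 2 < 2 := by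
        rw [div_lt_iff₀ hnpos]
        gcongr
      linarith
    · have hj : (0 : ℝ) < (j : ℕ) := Nat.cast_pos.mpr (Fin.pos_iff_ne_zero.mpr h)
      have : 0 < 2 * ((j : ℕ) : ℝ) ^ 2 / (n : ℝ) ^ 2 := by positivity
      linarith
  rw [sum_erase_zero_eq_last hn0 _ fun j h h' => by rw [am j h h', mul_zero],
    Fin.val_last] at h2
  rw [sum_erase_zero_eq_last hn0 _ am] at h1
  have al : a (Fin.last n) = -(1 / (6 * (n : ℝ) ^ 2)) := by
    field_simp
    linarith
  have a0 : a 0 = 1 + 1 / (3 * (n : ℝ) ^ 2) := by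
    rw [al] at h1
    field_simp at h1 ⊢
    linarith
  funext j
  by_cases hj : j = 0
  · rw [hj, a0, s0]
  by_cases hj' : (j : ℕ) = n
  · rw [show j = Fin.last n from Fin.ext hj', al, sl]
  · rw [am j hj hj', sm j hj hj']
end

section
/- Let n ≥ 2 and let G_n be the Goodman–Sharma operator. If f : [0,1] → ℝ is continuous and monotone nondecreasing on [0,1], then G_n f is monotone nondecreasing on [0,1]. -/
open Polynomial intervalIntegral

/-- The Goodman–Sharma operator
`G_n f = Lf + (n−1) Σ_{i=1}^{n−1} ⟨f − Lf, b_{i−1}^{(n−2)}⟩ b_i^{(n)}`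
where `Lf(x) = (1−x)f(0) + x f(1)` and `⟨f,g⟩ = ∫₀¹ f g`. -/
noncomputable def goodmanSharma (n : ℕ) (f : ℝ → ℝ) (x : ℝ) : ℝ :=
  ((1 - x) * f 0 + x * f 1) +
    ((n : ℝ) - 1) *
      ∑ i ∈ Finset.Icc 1 (n - 1),
        (∫ t in (0 : ℝ)..1,
            (f t - ((1 - t) * f 0 + t * f 1)) *
              (bernsteinPolynomial ℝ (n - 2) (i - 1)).eval t) *
          (bernsteinPolynomial ℝ n i).eval x

theorem integral_bernsteinPolynomial (m j : ℕ) (hj : j ≤ m) :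
    ∫ t in (0 : ℝ)..1, (bernsteinPolynomial ℝ m j).eval t = 1 / ((m : ℝ) + 1) := by
  have hm : (m : ℝ) + 1 ≠ 0 := by positivity
  have hint (k : ℕ) : IntervalIntegrable (fun t => (bernsteinPolynomial ℝ m k).eval t)
      MeasureTheory.volume 0 1 := (Polynomial.continuous _).intervalIntegrable _ _
  have hftc (p : ℝ[X]) : ∫ t in (0 : ℝ)..1, (derivative p).eval t = p.eval 1 - p.eval 0 :=
    integral_eq_sub_of_hasDerivAt (fun t _ => p.hasDerivAt t)
      ((Polynomial.continuous _).intervalIntegrable _ _)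
  induction j with
  | zero =>
    have h := hftc (bernsteinPolynomial ℝ (m + 1) 0)
    rw [bernsteinPolynomial.derivative_zero, bernsteinPolynomial.eval_at_0,
      bernsteinPolynomial.eval_at_1] at h
    simp only [Nat.add_sub_cancel, eval_mul, eval_neg, eval_natCast, integral_const_mul] at h
    push_cast at h
    simp at h
    field_simp
    linarith
  | succ j ih =>
    have h := hftc (bernsteinPolynomial ℝ (m + 1) (j + 1))
    rw [bernsteinPolynomial.derivative_succ, bernsteinPolynomial.eval_at_0,
      bernsteinPolynomial.eval_at_1, if_neg (by omega), if_neg (by omega)] at h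
    simp only [Nat.add_sub_cancel, eval_mul, eval_sub, eval_natCast, integral_const_mul] at h
    rw [integral_sub (hint _) (hint _), ih (by omega)] at h
    push_cast at h
    rcases mul_eq_zero.mp (h.trans (sub_zero 0)) with h | h
    · exact absurd h hm
    · linarith

theorem mul_eval_bernsteinPolynomial (m j : ℕ) (t : ℝ) :
    t * (bernsteinPolynomial ℝ m j).eval t =
      ((j : ℝ) + 1) / (m + 1) * (bernsteinPolynomial ℝ (m + 1) (j + 1)).eval t := by
  have h : ((m : ℝ) + 1) * m.choose j = (m + 1).choose (j + 1) * ((j : ℝ) + 1) := by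
    exact_mod_cast Nat.add_one_mul_choose_eq m j
  simp only [bernsteinPolynomial, eval_mul, eval_natCast, eval_pow, eval_X, eval_sub, eval_one,
    Nat.add_sub_add_right]
  field_simp
  linear_combination (t ^ (j + 1) * (1 - t) ^ (m - j)) * h

theorem integral_mul_bernsteinPolynomial (m j : ℕ) (hj : j ≤ m) :
    ∫ t in (0 : ℝ)..1, t * (bernsteinPolynomial ℝ m j).eval t =
      ((j : ℝ) + 1) / ((m + 1) * (m + 2)) := by
  simp only [mul_eval_bernsteinPolynomial, integral_const_mul]
  rw [integral_bernsteinPolynomial _ _ (by omega)]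
  push_cast
  field_simp
  ring

theorem eval_bernsteinPolynomial_nonneg (m j : ℕ) {t : ℝ} (ht : t ∈ Set.Icc (0 : ℝ) 1) :
    0 ≤ (bernsteinPolynomial ℝ m j).eval t := by
  have h0 := ht.1
  have h1 : 0 ≤ 1 - t := sub_nonneg.2 ht.2
  simp only [bernsteinPolynomial, eval_mul, eval_natCast, eval_pow, eval_X, eval_sub, eval_one]
  positivity

theorem eval_bernsteinPolynomial_succ_sub (m j : ℕ) (hj : j < m) (t : ℝ) :
    (bernsteinPolynomial ℝ m (j + 1)).eval t - (bernsteinPolynomial ℝ m j).eval t =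
      (m.choose j : ℝ) * (m + 1) / (j + 1) * t ^ j * (1 - t) ^ (m - (j + 1)) *
        (t - (j + 1) / (m + 1)) := by
  obtain ⟨k, rfl⟩ := Nat.exists_eq_add_of_lt hj
  have h : ((j + k + 1).choose (j + 1) : ℝ) * (j + 1) = (j + k + 1).choose j * (k + 1) := by
    have := Nat.choose_succ_right_eq (j + k + 1) j
    rw [show j + k + 1 - j = k + 1 by omega] at this
    exact_mod_cast this
  have h' : ((j + k + 1).choose (j + 1) : ℝ) = (j + k + 1).choose j * (k + 1) / (j + 1) := by
    field_simp
    linarith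
  simp only [bernsteinPolynomial, eval_mul, eval_natCast, eval_pow, eval_X, eval_sub, eval_one]
  rw [h', show j + k + 1 - j = k + 1 by omega, show j + k + 1 - (j + 1) = k by omega]
  push_cast
  field_simp
  ring

/-- A polynomial with nondecreasing Bernstein coefficients is nondecreasing on `[0,1]`. -/
theorem monotoneOn_sum_bernsteinPolynomial (n : ℕ) (c : ℕ → ℝ) (hc : ∀ i < n, c i ≤ c (i + 1)) :
    MonotoneOn (fun x => ∑ i ∈ Finset.range (n + 1), c i * (bernsteinPolynomial ℝ n i).eval x)
      (Set.Icc 0 1) := by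
  rcases n with _ | n
  · intro x _ y _ _
    simp [bernsteinPolynomial]
  set p : ℝ[X] := ∑ i ∈ Finset.range (n + 1 + 1), C (c i) * bernsteinPolynomial ℝ (n + 1) i with hp
  have hpe : (fun x => ∑ i ∈ Finset.range (n + 1 + 1),
      c i * (bernsteinPolynomial ℝ (n + 1) i).eval x) = fun x => p.eval x := by
    funext x
    simp [hp, eval_finsetSum]
  have hder : derivative p = ((n : ℝ[X]) + 1) *
      ∑ i ∈ Finset.range (n + 1), C (c (i + 1) - c i) * bernsteinPolynomial ℝ n i := by
    have hshift : ∑ i ∈ Finset.range (n + 1), C (c (i + 1)) * bernsteinPolynomial ℝ n (i + 1) +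
        C (c 0) * bernsteinPolynomial ℝ n 0 =
        ∑ i ∈ Finset.range (n + 1), C (c i) * bernsteinPolynomial ℝ n i := by
      rw [← Finset.sum_range_succ' (fun i => C (c i) * bernsteinPolynomial ℝ n i),
        Finset.sum_range_succ, bernsteinPolynomial.eq_zero_of_lt ℝ (Nat.lt_succ_self n)]
      simp
    rw [hp, derivative_sum, Finset.sum_range_succ']
    simp only [derivative_C_mul, bernsteinPolynomial.derivative_succ,
      bernsteinPolynomial.derivative_zero, Nat.add_sub_cancel, C_sub, sub_mul,
      Finset.sum_sub_distrib, ← hshift]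
    simp only [mul_left_comm (C _), ← Finset.mul_sum, mul_sub, Finset.sum_sub_distrib]
    push_cast
    ring
  rw [hpe]
  refine monotoneOn_of_deriv_nonneg (convex_Icc 0 1) p.continuous.continuousOn
    p.differentiable.differentiableOn fun x hx => ?_
  rw [Polynomial.deriv, hder]
  simp only [eval_mul, eval_add, eval_natCast, eval_one, eval_finsetSum, eval_C]
  refine mul_nonneg (by positivity) (Finset.sum_nonneg fun i hi => mul_nonneg ?_
    (eval_bernsteinPolynomial_nonneg n i (interior_subset hx)))
  exact sub_nonneg.2 (hc i (Finset.mem_range.1 hi))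

theorem intervalIntegrable_mul_bernsteinPolynomial {f : ℝ → ℝ}
    (hf : ContinuousOn f (Set.Icc 0 1)) (m j : ℕ) :
    IntervalIntegrable (fun t => f t * (bernsteinPolynomial ℝ m j).eval t)
      MeasureTheory.volume 0 1 := by
  refine ContinuousOn.intervalIntegrable_of_Icc zero_le_one ?_
  exact hf.mul (Polynomial.continuous _).continuousOn

/-- The inner products of a nondecreasing function with the Bernstein basis are nondecreasing. -/
theorem integral_mul_bernsteinPolynomial_le_succ {f : ℝ → ℝ}
    (hf : ContinuousOn f (Set.Icc 0 1)) (hmono : MonotoneOn f (Set.Icc 0 1)) (m j : ℕ)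
    (hj : j < m) :
    ∫ t in (0 : ℝ)..1, f t * (bernsteinPolynomial ℝ m j).eval t ≤
      ∫ t in (0 : ℝ)..1, f t * (bernsteinPolynomial ℝ m (j + 1)).eval t := by
  set s : ℝ := ((j : ℝ) + 1) / (m + 1) with hs_def
  have hs : s ∈ Set.Icc (0 : ℝ) 1 := by
    refine ⟨by positivity, (div_le_one (by positivity)).2 ?_⟩
    have : (j : ℝ) < m := by exact_mod_cast hj
    linarith
  have hg : ContinuousOn (fun t => f t - f s) (Set.Icc 0 1) := hf.sub continuousOn_const
  have key : ∫ t in (0 : ℝ)..1, (f t - f s) * (bernsteinPolynomial ℝ m j).eval t ≤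
      ∫ t in (0 : ℝ)..1, (f t - f s) * (bernsteinPolynomial ℝ m (j + 1)).eval t := by
    refine integral_mono_on zero_le_one (intervalIntegrable_mul_bernsteinPolynomial hg _ _)
      (intervalIntegrable_mul_bernsteinPolynomial hg _ _) fun t ht => ?_
    rw [← sub_nonneg, ← mul_sub, eval_bernsteinPolynomial_succ_sub m j hj, mul_left_comm]
    have h0 := ht.1
    have h1 : 0 ≤ 1 - t := sub_nonneg.2 ht.2
    refine mul_nonneg (by positivity) ?_
    rcases le_total t s with h | h
    · exact mul_nonneg_of_nonpos_of_nonpos (sub_nonpos.2 (hmono ht hs h)) (sub_nonpos.2 h)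
    · exact mul_nonneg (sub_nonneg.2 (hmono hs ht h)) (sub_nonneg.2 h)
  have hconst (k : ℕ) (hk : k ≤ m) :
      ∫ t in (0 : ℝ)..1, (f t - f s) * (bernsteinPolynomial ℝ m k).eval t =
      (∫ t in (0 : ℝ)..1, f t * (bernsteinPolynomial ℝ m k).eval t) - f s * (1 / (m + 1)) := by
    simp only [sub_mul]
    rw [integral_sub (intervalIntegrable_mul_bernsteinPolynomial hf _ _)
      (intervalIntegrable_mul_bernsteinPolynomial continuousOn_const _ _), integral_const_mul,
      integral_bernsteinPolynomial _ _ hk]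
  rw [hconst j hj.le, hconst (j + 1) hj] at key
  linarith

theorem add_one_mul_integral_bernsteinPolynomial_mem_Icc {f : ℝ → ℝ}
    (hf : ContinuousOn f (Set.Icc 0 1)) (hmono : MonotoneOn f (Set.Icc 0 1)) (m j : ℕ)
    (hj : j ≤ m) :
    ((m : ℝ) + 1) * ∫ t in (0 : ℝ)..1, f t * (bernsteinPolynomial ℝ m j).eval t ∈
      Set.Icc (f 0) (f 1) := by
  have hconst (a : ℝ) : a = ((m : ℝ) + 1) *
      ∫ t in (0 : ℝ)..1, a * (bernsteinPolynomial ℝ m j).eval t := by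
    rw [integral_const_mul, integral_bernsteinPolynomial _ _ hj]
    field_simp
  have hi (a : ℝ) := intervalIntegrable_mul_bernsteinPolynomial (f := fun _ => a)
    continuousOn_const m j
  have hif := intervalIntegrable_mul_bernsteinPolynomial hf m j
  constructor
  · rw [hconst (f 0)]
    refine mul_le_mul_of_nonneg_left (integral_mono_on zero_le_one (hi _) hif fun t ht => ?_)
      (by positivity)
    exact mul_le_mul_of_nonneg_right (hmono (by simp) ht ht.1)
      (eval_bernsteinPolynomial_nonneg m j ht)
  · rw [hconst (f 1)]
    refine mul_le_mul_of_nonneg_left (integral_mono_on zero_le_one hif (hi _) fun t ht => ?_)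
      (by positivity)
    exact mul_le_mul_of_nonneg_right (hmono ht (by simp) ht.2)
      (eval_bernsteinPolynomial_nonneg m j ht)

/-- The Bernstein coefficients of `G_{m+2} f`. -/
noncomputable def goodmanSharmaCoeff (m : ℕ) (f : ℝ → ℝ) : ℕ → ℝ
  | 0 => f 0
  | j + 1 => if j = m + 1 then f 1 else
      ((m : ℝ) + 1) * ∫ t in (0 : ℝ)..1, f t * (bernsteinPolynomial ℝ m j).eval t

theorem goodmanSharma_eq_sum_coeff (m : ℕ) {f : ℝ → ℝ} (hf : ContinuousOn f (Set.Icc 0 1))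
    (x : ℝ) :
    goodmanSharma (m + 2) f x = ∑ i ∈ Finset.range (m + 2 + 1),
      goodmanSharmaCoeff m f i * (bernsteinPolynomial ℝ (m + 2) i).eval x := by
  have hone : ∑ i ∈ Finset.range (m + 2 + 1), (bernsteinPolynomial ℝ (m + 2) i).eval x = 1 := by
    rw [← eval_finsetSum, bernsteinPolynomial.sum, eval_one]
  have hX : ∑ i ∈ Finset.range (m + 2 + 1),
      (i : ℝ) * (bernsteinPolynomial ℝ (m + 2) i).eval x = ((m : ℝ) + 2) * x := by
    have h := congrArg (Polynomial.eval x) (bernsteinPolynomial.sum_smul ℝ (m + 2))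
    simpa [eval_finsetSum] using h
  have hint (j : ℕ) (hj : j < m + 1) : ((m : ℝ) + 1) * ∫ t in (0 : ℝ)..1,
      (f t - ((1 - t) * f 0 + t * f 1)) * (bernsteinPolynomial ℝ m j).eval t =
      goodmanSharmaCoeff m f (j + 1) - f 0 - (f 1 - f 0) / (m + 2) * ((j + 1 : ℕ) : ℝ) := by
    have h1 := intervalIntegrable_mul_bernsteinPolynomial hf m j
    have h2 := intervalIntegrable_mul_bernsteinPolynomial (f := fun _ => f 0)
      continuousOn_const m j
    have h3 := (intervalIntegrable_mul_bernsteinPolynomial (f := fun t => t)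
      continuousOn_id m j).const_mul (f 1 - f 0)
    have heq (t : ℝ) : (f t - ((1 - t) * f 0 + t * f 1)) * (bernsteinPolynomial ℝ m j).eval t =
        f t * (bernsteinPolynomial ℝ m j).eval t - f 0 * (bernsteinPolynomial ℝ m j).eval t -
          (f 1 - f 0) * (t * (bernsteinPolynomial ℝ m j).eval t) := by ring
    simp only [heq]
    rw [integral_sub (h1.sub h2) h3, integral_sub h1 h2, integral_const_mul, integral_const_mul,
      integral_bernsteinPolynomial _ _ (by omega), integral_mul_bernsteinPolynomial _ _ (by omega),
      goodmanSharmaCoeff, if_neg (by omega)]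
    push_cast
    field_simp
  have hsum : (((m + 2 : ℕ) : ℝ) - 1) * ∑ i ∈ Finset.Icc 1 (m + 2 - 1),
      (∫ t in (0 : ℝ)..1, (f t - ((1 - t) * f 0 + t * f 1)) *
        (bernsteinPolynomial ℝ (m + 2 - 2) (i - 1)).eval t) *
          (bernsteinPolynomial ℝ (m + 2) i).eval x =
      ∑ j ∈ Finset.range (m + 1), (goodmanSharmaCoeff m f (j + 1) - f 0 -
        (f 1 - f 0) / (m + 2) * ((j + 1 : ℕ) : ℝ)) *
          (bernsteinPolynomial ℝ (m + 2) (j + 1)).eval x := by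
    rw [Finset.mul_sum, Finset.range_eq_Ico, ← Finset.Ico_add_one_right_eq_Icc,
      Finset.sum_Ico_eq_sum_range, Finset.sum_Ico_eq_sum_range]
    refine Finset.sum_congr (by simp) fun j hj => ?_
    have hj' : j < m + 1 := by simpa using hj
    rw [← mul_assoc, zero_add, ← hint j hj', add_comm 1 j, Nat.add_sub_cancel,
      Nat.add_sub_cancel]
    push_cast
    ring
  rw [goodmanSharma, hsum]
  have h0 : goodmanSharmaCoeff m f 0 = f 0 := rfl
  have h1 : goodmanSharmaCoeff m f (m + 2) = f 1 := by simp [goodmanSharmaCoeff]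
  rw [Finset.sum_range_succ _ (m + 2), Finset.sum_range_succ' _ (m + 1)] at hone hX ⊢
  rw [h0, h1]
  simp only [sub_mul, mul_assoc, Finset.sum_sub_distrib, ← Finset.mul_sum]
  push_cast at hX hone ⊢
  generalize ∑ j ∈ Finset.range (m + 1), ((j : ℝ) + 1) *
    (bernsteinPolynomial ℝ (m + 2) (j + 1)).eval x = A at *
  generalize ∑ j ∈ Finset.range (m + 1), (bernsteinPolynomial ℝ (m + 2) (j + 1)).eval x = B at *
  generalize ∑ j ∈ Finset.range (m + 1), goodmanSharmaCoeff m f (j + 1) *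
    (bernsteinPolynomial ℝ (m + 2) (j + 1)).eval x = D at *
  generalize (bernsteinPolynomial ℝ (m + 2) 0).eval x = P at *
  generalize (bernsteinPolynomial ℝ (m + 2) (m + 2)).eval x = Q at *
  field_simp
  linear_combination (f 0 - f 1) * hX - ((m : ℝ) + 2) * f 0 * hone

/-- **The Goodman–Sharma operator preserves monotonicity.**  For `n ≥ 2`, if
`f` is continuous and nondecreasing on `[0,1]`, then so is `G_n f`. -/
theorem goodmanSharma_preserves_monotone (n : ℕ) (hn : 2 ≤ n) (f : ℝ → ℝ)
    (hf : ContinuousOn f (Set.Icc 0 1)) (hmono : MonotoneOn f (Set.Icc 0 1)) :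
    MonotoneOn (goodmanSharma n f) (Set.Icc 0 1) := by
  obtain ⟨m, rfl⟩ := Nat.exists_eq_add_of_le' hn
  rw [funext (goodmanSharma_eq_sum_coeff m hf)]
  refine monotoneOn_sum_bernsteinPolynomial (m + 2) _ fun i hi => ?_
  rcases i with _ | j
  · rw [goodmanSharmaCoeff, goodmanSharmaCoeff, if_neg (by omega)]
    exact (add_one_mul_integral_bernsteinPolynomial_mem_Icc hf hmono m 0 (Nat.zero_le m)).1
  · rw [goodmanSharmaCoeff, goodmanSharmaCoeff, if_neg (by omega)]
    split_ifs with h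
    · exact (add_one_mul_integral_bernsteinPolynomial_mem_Icc hf hmono m j (by omega)).2
    · exact mul_le_mul_of_nonneg_left
        (integral_mul_bernsteinPolynomial_le_succ hf hmono m j (by omega)) (by positivity)
end

section
/- For every integer n ≥ 1, there exists a unique family of real polynomials β₀^{(n)}, β₁^{(n)}, …, β_n^{(n)}, with deg β_k^{(n)} ≤ k for each k, such that for every polynomial p of degree at most n one has B_n p = Σ_{k=0}^{n} β_k^{(n)} · p^{(k)}, where p^{(k)} denotes the k-th derivative of p. -/
open Polynomial

/-- The Bernstein operator `B_n p = Σ_{i=0}^n p(i/n) b_i^{(n)}` acting on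
real polynomials. -/
noncomputable def bernsteinOp (n : ℕ) (p : Polynomial ℝ) : Polynomial ℝ :=
  ∑ i ∈ Finset.range (n + 1),
    Polynomial.C (p.eval ((i : ℝ) / (n : ℝ))) * bernsteinPolynomial ℝ n i

theorem bernsteinPolynomial.X_mul_one_sub_X_mul_derivative {R : Type*} [CommRing R] {n i : ℕ}
    (hi : i ≤ n) :
    X * (1 - X) * derivative (bernsteinPolynomial R n i) =
      ((i : R[X]) - (n : R[X]) * X) * bernsteinPolynomial R n i := by
  obtain ⟨m, rfl⟩ := Nat.exists_eq_add_of_le hi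
  have key : ∀ (a : R[X]) (j : ℕ), a * ((j : R[X]) * a ^ (j - 1)) = (j : R[X]) * a ^ j := by
    rintro a (_ | j)
    · simp
    · rw [Nat.add_sub_cancel]
      ring
  have hX := key X i
  have hY := key (1 - X) m
  simp only [bernsteinPolynomial, Nat.add_sub_cancel_left, derivative_mul, derivative_natCast,
    derivative_pow, derivative_X, derivative_sub, derivative_one, map_natCast]
  push_cast
  linear_combination ((i + m).choose i : R[X]) * (1 - X) ^ m * (1 - X) * hX -
    ((i + m).choose i : R[X]) * X ^ i * X * hY

/-- The `k`-th central moment `Σ_{i=0}^n (i/n - X)^k b_i^{(n)}` of the Bernstein operator. -/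
noncomputable def bernsteinCentralMoment (n k : ℕ) : ℝ[X] :=
  ∑ i ∈ Finset.range (n + 1), (C ((i : ℝ) / (n : ℝ)) - X) ^ k * bernsteinPolynomial ℝ n i

theorem bernsteinCentralMoment_zero (n : ℕ) : bernsteinCentralMoment n 0 = 1 := by
  simp [bernsteinCentralMoment, bernsteinPolynomial.sum]

theorem natCast_mul_C_div_sub_X {n : ℕ} (hn : n ≠ 0) (i : ℕ) :
    (n : ℝ[X]) * (C ((i : ℝ) / (n : ℝ)) - X) = (i : ℝ[X]) - (n : ℝ[X]) * X := by
  have hn' : (n : ℝ) ≠ 0 := Nat.cast_ne_zero.mpr hn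
  rw [mul_sub, ← map_natCast (C : ℝ →+* ℝ[X]) n, ← C_mul, mul_div_cancel₀ _ hn', map_natCast]

theorem natCast_mul_bernsteinCentralMoment_succ {n : ℕ} (hn : n ≠ 0) (k : ℕ) :
    (n : ℝ[X]) * bernsteinCentralMoment n (k + 1) =
      X * (1 - X) * (derivative (bernsteinCentralMoment n k) +
        (k : ℝ[X]) * bernsteinCentralMoment n (k - 1)) := by
  simp only [bernsteinCentralMoment, derivative_sum, Finset.mul_sum, ← Finset.sum_add_distrib]
  refine Finset.sum_congr rfl fun i hi => ?_
  have hb := bernsteinPolynomial.X_mul_one_sub_X_mul_derivative (R := ℝ)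
    (Finset.mem_range_succ_iff.mp hi)
  have hc := natCast_mul_C_div_sub_X hn i
  simp only [derivative_mul, derivative_pow, derivative_sub, derivative_C, derivative_X,
    map_natCast]
  linear_combination (C ((i : ℝ) / (n : ℝ)) - X) ^ k * bernsteinPolynomial ℝ n i * hc -
    (C ((i : ℝ) / (n : ℝ)) - X) ^ k * hb

theorem natDegree_bernsteinCentralMoment_le {n : ℕ} (hn : n ≠ 0) (k : ℕ) :
    (bernsteinCentralMoment n k).natDegree ≤ k := by
  have hXX : (X * (1 - X) : ℝ[X]).natDegree ≤ 2 := by compute_degree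
  have hC : ∀ (m : ℕ) (q : ℝ[X]), ((m : ℝ[X]) * q).natDegree ≤ q.natDegree := fun m q => by
    rw [← map_natCast (C : ℝ →+* ℝ[X]) m]
    exact natDegree_C_mul_le _ _
  have step : ∀ k, (bernsteinCentralMoment n (k + 1)).natDegree =
      ((n : ℝ[X]) * bernsteinCentralMoment n (k + 1)).natDegree := fun k => by
    rw [← map_natCast (C : ℝ →+* ℝ[X]) n, natDegree_C_mul (Nat.cast_ne_zero.mpr hn)]
  induction k using Nat.twoStepInduction with
  | zero => simp [bernsteinCentralMoment_zero]
  | one =>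
    rw [step, natCast_mul_bernsteinCentralMoment_succ hn, bernsteinCentralMoment_zero]
    simp
  | more k ih₀ ih₁ =>
    rw [step, natCast_mul_bernsteinCentralMoment_succ hn, Nat.add_sub_cancel]
    have hd := natDegree_derivative_le (bernsteinCentralMoment n (k + 1))
    have hadd := natDegree_add_le_of_degree_le (n := k)
      (p := derivative (bernsteinCentralMoment n (k + 1))) (by omega)
      ((hC (k + 1) _).trans ih₀)
    exact (natDegree_mul_le_of_le hXX hadd).trans (by omega)

theorem C_eval_eq_sum_iterate_derivative {p : ℝ[X]} {n : ℕ} (hp : p.natDegree ≤ n) (y : ℝ) :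
    C (p.eval y) = ∑ k ∈ Finset.range (n + 1),
      C ((k.factorial : ℝ)⁻¹) * (C y - X) ^ k * derivative^[k] p := by
  refine Polynomial.funext fun x => ?_
  have ht : p.eval y = (taylor x p).eval (y - x) := by simp [taylor_eval]
  rw [eval_C, ht, eval_eq_sum_range' (n := n + 1) (by rw [natDegree_taylor]; omega),
    eval_finsetSum]
  refine Finset.sum_congr rfl fun k _ => ?_
  have hk : (k.factorial : ℝ) ≠ 0 := Nat.cast_ne_zero.mpr k.factorial_ne_zero
  have hd : (derivative^[k] p).eval x = k.factorial * (taylor x p).coeff k := by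
    rw [taylor_coeff, ← factorial_smul_hasseDeriv]
    simp
  simp only [eval_mul, eval_C, eval_pow, eval_sub, eval_X, hd]
  field_simp

theorem bernsteinOp_eq_sum_iterate_derivative {p : ℝ[X]} {n : ℕ} (hp : p.natDegree ≤ n) :
    bernsteinOp n p = ∑ k ∈ Finset.range (n + 1),
      C ((k.factorial : ℝ)⁻¹) * bernsteinCentralMoment n k * derivative^[k] p := by
  simp only [bernsteinOp, bernsteinCentralMoment, C_eval_eq_sum_iterate_derivative hp,
    Finset.sum_mul, Finset.mul_sum]
  rw [Finset.sum_comm]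
  refine Finset.sum_congr rfl fun k _ => Finset.sum_congr rfl fun i _ => ?_
  ring

/-- The coefficients of a differential operator of order at most `n` are determined by its action
on polynomials of degree at most `n`. -/
theorem eq_of_sum_mul_iterate_derivative_eq {n : ℕ} {β γ : Fin (n + 1) → ℝ[X]}
    (h : ∀ p : ℝ[X], p.degree ≤ (n : ℕ) →
      ∑ k : Fin (n + 1), β k * derivative^[(k : ℕ)] p =
        ∑ k : Fin (n + 1), γ k * derivative^[(k : ℕ)] p) :
    β = γ := by
  funext k
  induction k using WellFoundedLT.induction with
  | ind k ih =>
    have hk := h (X ^ (k : ℕ)) ((degree_X_pow_le _).trans (by exact_mod_cast k.is_le))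
    rw [← sub_eq_zero, ← Finset.sum_sub_distrib, Finset.sum_eq_single k] at hk
    · rw [← sub_mul, iterate_derivative_X_pow_eq_C_mul, Nat.descFactorial_self, Nat.sub_self,
        pow_zero, mul_one, mul_eq_zero, C_eq_zero, Nat.cast_eq_zero] at hk
      exact sub_eq_zero.mp (hk.resolve_right (Nat.factorial_ne_zero _))
    · intro j _ hj
      rcases lt_or_gt_of_ne hj with hj | hj
      · rw [ih j hj, sub_self]
      · rw [iterate_derivative_eq_zero ((natDegree_X_pow_le _).trans_lt hj), mul_zero, mul_zero,
          sub_self]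
    · simp

/-- **Differential-form expansion of the Bernstein operator.**  For `n ≥ 1`,
there is a unique family of polynomials `β₀^{(n)},…,β_n^{(n)}` with
`deg β_k ≤ k` such that `B_n p = Σ_{k=0}^n β_k^{(n)} p^{(k)}` for every
polynomial `p` of degree at most `n`. -/
theorem bernstein_differential_expansion (n : ℕ) (hn : 1 ≤ n) :
    ∃! β : Fin (n + 1) → Polynomial ℝ,
      (∀ k : Fin (n + 1), (β k).degree ≤ (k : ℕ)) ∧
      ∀ p : Polynomial ℝ, p.degree ≤ (n : ℕ) →
        bernsteinOp n p = ∑ k : Fin (n + 1), β k * (Polynomial.derivative^[(k : ℕ)] p) := by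
  refine ⟨fun k => C (((k : ℕ).factorial : ℝ)⁻¹) * bernsteinCentralMoment n k,
    ⟨fun k => ?_, fun p hp => ?_⟩, fun γ hγ => ?_⟩
  · exact natDegree_le_iff_degree_le.mp ((natDegree_C_mul_le _ _).trans
      (natDegree_bernsteinCentralMoment_le (by omega) k))
  · rw [bernsteinOp_eq_sum_iterate_derivative (natDegree_le_iff_degree_le.mpr hp),
      Finset.sum_range]
  · refine eq_of_sum_mul_iterate_derivative_eq fun p hp => ?_
    rw [← hγ.2 p hp, bernsteinOp_eq_sum_iterate_derivative (natDegree_le_iff_degree_le.mpr hp),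
      Finset.sum_range]
end

section
/- Let n ≥ 1, let A_n be the inverse of the Bernstein operator B_n on the space P_n of polynomials of degree at most n, and let α₀^{(n)}, …, α_n^{(n)} be the unique polynomials with deg α_k^{(n)} ≤ k such that A_n p = Σ_{k=0}^{n} α_k^{(n)} p^{(k)} for all p ∈ P_n. For 0 ≤ r ≤ n define the partial inverse A_n^{(r)} p = Σ_{k=0}^{r} α_k^{(n)} p^{(k)}. Then for every polynomial p of degree at most r, both A_n^{(r)}(B_n p) = p and B_n(A_n^{(r)} p) = p; that is, the left Bernstein quasi-interpolant B_n^{(r)} = A_n^{(r)} ∘ B_n and the right Bernstein quasi-interpolant B_n^{[r]} = B_n ∘ A_n^{(r)} are exact on P_r. -/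
open Polynomial

theorem X_mul_one_sub_X_mul_derivative_bernsteinPolynomial {n i : ℕ} (hi : i ≤ n) :
    X * (1 - X) * derivative (bernsteinPolynomial ℝ n i) =
      ((i : ℝ[X]) - (n : ℝ[X]) * X) * bernsteinPolynomial ℝ n i := by
  obtain ⟨j, rfl⟩ := Nat.exists_eq_add_of_le hi
  have hX : X * derivative ((X : ℝ[X]) ^ i) = (i : ℝ[X]) * X ^ i := by
    rcases i with _ | i
    · simp
    · rw [derivative_X_pow_succ, map_add, map_natCast, map_one]; push_cast; ring
  have hY : (1 - X) * derivative ((1 - X : ℝ[X]) ^ j) =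
      -((j : ℝ[X]) * (1 - X) ^ j) := by
    rcases j with _ | j
    · simp
    · rw [derivative_pow_succ, derivative_sub, derivative_one, derivative_X, map_add,
        map_natCast, map_one]
      push_cast
      ring
  simp only [bernsteinPolynomial, derivative_mul, derivative_natCast, Nat.add_sub_cancel_left,
    Nat.cast_add]
  linear_combination ((i + j).choose i : ℝ[X]) * (1 - X) * (1 - X) ^ j * hX +
    ((i + j).choose i : ℝ[X]) * X * X ^ i * hY

/-- The Bernstein operator as a linear map. -/
noncomputable def bernsteinLinearMap (n : ℕ) : ℝ[X] →ₗ[ℝ] ℝ[X] where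
  toFun := bernsteinOp n
  map_add' p q := by simp [bernsteinOp, add_mul, Finset.sum_add_distrib]
  map_smul' c p := by simp [bernsteinOp, Finset.smul_sum, smul_eq_C_mul, mul_assoc]

theorem bernsteinOp_one (n : ℕ) : bernsteinOp n 1 = 1 := by
  simpa [bernsteinOp] using bernsteinPolynomial.sum ℝ n

theorem natCast_mul_bernsteinOp_X_mul {n : ℕ} (hn : n ≠ 0) (p : ℝ[X]) :
    (n : ℝ[X]) * bernsteinOp n (X * p) =
      (n : ℝ[X]) * X * bernsteinOp n p + X * (1 - X) * derivative (bernsteinOp n p) := by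
  simp only [bernsteinOp, Finset.mul_sum, derivative_sum, ← Finset.sum_add_distrib]
  refine Finset.sum_congr rfl fun i hi => ?_
  have h := X_mul_one_sub_X_mul_derivative_bernsteinPolynomial (Finset.mem_range_succ_iff.1 hi)
  have hc : (n : ℝ[X]) * C ((i : ℝ) / n) = i := by
    rw [← C_eq_natCast, ← C_mul, mul_div_cancel₀ _ (Nat.cast_ne_zero.2 hn), C_eq_natCast]
  simp only [eval_mul, eval_X, C_mul, derivative_C_mul]
  linear_combination C (p.eval ((i : ℝ) / n)) * bernsteinPolynomial ℝ n i * hc -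
    C (p.eval ((i : ℝ) / n)) * h

theorem natDegree_bernsteinOp_X_pow_le {n : ℕ} (hn : n ≠ 0) (m : ℕ) :
    (bernsteinOp n (X ^ m)).natDegree ≤ m := by
  induction m with
  | zero => simp [bernsteinOp_one]
  | succ m ih =>
    have hC : (C (n : ℝ)) * bernsteinOp n (X ^ (m + 1)) =
        (n : ℝ[X]) * X * bernsteinOp n (X ^ m) +
        X * (1 - X) * derivative (bernsteinOp n (X ^ m)) := by
      rw [pow_succ', C_eq_natCast, natCast_mul_bernsteinOp_X_mul hn]
    rw [← natDegree_C_mul (Nat.cast_ne_zero.2 hn : (n : ℝ) ≠ 0), hC]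
    refine natDegree_add_le_of_degree_le ?_ ?_
    · have : ((n : ℝ[X]) * X).natDegree ≤ 1 := by compute_degree
      exact natDegree_mul_le.trans (by omega)
    · have h2 : ((X : ℝ[X]) * (1 - X)).natDegree ≤ 2 := by compute_degree
      rcases Nat.eq_zero_or_pos m with rfl | hm
      · simp [bernsteinOp_one]
      · have := natDegree_derivative_le (bernsteinOp n (X ^ m))
        exact natDegree_mul_le.trans (by omega)

theorem bernsteinLinearMap_mem_degreeLT {n : ℕ} (hn : n ≠ 0) {m : ℕ} {p : ℝ[X]}
    (hp : p ∈ degreeLT ℝ m) : bernsteinLinearMap n p ∈ degreeLT ℝ m := by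
  classical
  have hle : degreeLT ℝ m ≤ (degreeLT ℝ m).comap (bernsteinLinearMap n) := by
    conv_lhs => rw [degreeLT_eq_span_X_pow]
    rw [Submodule.span_le]
    intro q hq
    simp only [Finset.coe_image, Set.mem_image, Finset.coe_range, Set.mem_Iio] at hq
    obtain ⟨k, hk, rfl⟩ := hq
    rw [SetLike.mem_coe, Submodule.mem_comap, mem_degreeLT]
    exact (degree_le_of_natDegree_le (natDegree_bernsteinOp_X_pow_le hn k)).trans_lt
      (Nat.cast_lt.2 hk)
  exact hle hp

theorem mem_degreeLT_succ_iff {R : Type*} [Semiring R] {p : R[X]} {r : ℕ} :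
    p ∈ degreeLT R (r + 1) ↔ p.degree ≤ (r : ℕ) := by
  rw [degreeLT_succ_eq_degreeLE, mem_degreeLE]

/-- **Exactness of left and right Bernstein quasi-interpolants on `P_r`.**
Let `n ≥ 1` and let `α₀^{(n)},…,α_n^{(n)}` be the polynomials, with
`deg α_k ≤ k`, representing the inverse `A_n` of the Bernstein operator on
`P_n` as the differential operator `A_n p = Σ_{k=0}^n α_k^{(n)} p^{(k)}`
(i.e. `Σ_{k=0}^n α_k^{(n)} (B_n p)^{(k)} = p` for all `p ∈ P_n`).  Then for
`0 ≤ r ≤ n`, the partial inverse `A_n^{(r)} p = Σ_{k=0}^r α_k^{(n)} p^{(k)}`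
satisfies, for every `p` of degree at most `r`, both
`A_n^{(r)}(B_n p) = p` and `B_n (A_n^{(r)} p) = p`: the left quasi-interpolant
`B_n^{(r)} = A_n^{(r)} ∘ B_n` and the right quasi-interpolant
`B_n^{[r]} = B_n ∘ A_n^{(r)}` are exact on `P_r`. -/
theorem bernstein_quasi_interpolants_exact (n r : ℕ) (hn : 1 ≤ n) (hr : r ≤ n)
    (α : ℕ → Polynomial ℝ)
    (hdeg : ∀ k, k ≤ n → (α k).degree ≤ (k : ℕ))
    (hinv : ∀ p : Polynomial ℝ, p.degree ≤ (n : ℕ) →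
      (∑ k ∈ Finset.range (n + 1),
        α k * (Polynomial.derivative^[k] (bernsteinOp n p))) = p) :
    ∀ p : Polynomial ℝ, p.degree ≤ (r : ℕ) →
      (∑ k ∈ Finset.range (r + 1),
          α k * (Polynomial.derivative^[k] (bernsteinOp n p))) = p ∧
      bernsteinOp n
          (∑ k ∈ Finset.range (r + 1), α k * (Polynomial.derivative^[k] p)) = p := by
  have hn0 : n ≠ 0 := Nat.one_le_iff_ne_zero.1 hn
  have hB : ∀ p ∈ degreeLT ℝ (r + 1), bernsteinLinearMap n p ∈ degreeLT ℝ (r + 1) :=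
    fun p hp => bernsteinLinearMap_mem_degreeLT hn0 hp
  have hleft : ∀ p ∈ degreeLT ℝ (r + 1), ∑ k ∈ Finset.range (r + 1),
      α k * derivative^[k] (bernsteinOp n p) = p := by
    intro p hp
    refine Eq.trans ?_ (hinv p ((mem_degreeLT_succ_iff.1 hp).trans (Nat.cast_le.2 hr)))
    refine Finset.sum_subset (Finset.range_mono (by omega)) fun k _ hk => ?_
    have hBp : degree (bernsteinOp n p) < (r + 1 : ℕ) := mem_degreeLT.1 (hB p hp)
    rw [Finset.mem_range, not_lt] at hk
    rw [iterate_derivative_eq_zero_of_degree_lt (hBp.trans_le (Nat.cast_le.2 hk)), mul_zero]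
  intro p hp
  rw [← mem_degreeLT_succ_iff] at hp
  refine ⟨hleft p hp, ?_⟩
  have : FiniteDimensional ℝ (degreeLT ℝ (r + 1)) := (degreeLTEquiv ℝ (r + 1)).symm.finiteDimensional
  have hinj : Function.Injective ((bernsteinLinearMap n).restrict hB) := by
    intro p q hpq
    have h : bernsteinOp n p = bernsteinOp n q := congrArg Subtype.val hpq
    exact Subtype.ext (by rw [← hleft p p.2, h, hleft q q.2])
  obtain ⟨q, hq⟩ := LinearMap.injective_iff_surjective.1 hinj ⟨p, hp⟩
  have hqp : bernsteinOp n q = p := congrArg Subtype.val hq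
  rw [← hqp, hleft q q.2]
end

section
/- Let n ≥ 1 and α ∈ ℝ, and for k ∈ ℕ let (x)_α^k = x(x+α)(x+2α)⋯(x+(k−1)α) denote the factorial power. Then for all real x the following polynomial identities hold: Σ_{k=0}^{n} C(n,k)·(x)_α^k·(1−x)_α^{n−k} = (1)_α^n and Σ_{k=0}^{n} k·C(n,k)·(x)_α^k·(1−x)_α^{n−k} = n·x·(1)_α^n. In particular, whenever (1)_α^n ≠ 0, the Bernstein–Stancu operator S_n^{(α)} reproduces every affine function. -/
open Finset

/-- The factorial power `(x)_α^k = x (x+α) (x+2α) ⋯ (x+(k−1)α)`. -/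
noncomputable def factPow (x α : ℝ) (k : ℕ) : ℝ :=
  ∏ j ∈ Finset.range k, (x + (j : ℝ) * α)

/-- The Bernstein–Stancu basis polynomial
`b_k^{(n)}(x,α) = C(n,k) (x)_α^k (1−x)_α^{n−k} / (1)_α^n`. -/
noncomputable def stancuBasis (n k : ℕ) (α x : ℝ) : ℝ :=
  (n.choose k : ℝ) * factPow x α k * factPow (1 - x) α (n - k) / factPow 1 α n

theorem factPow_succ (x α : ℝ) (k : ℕ) :
    factPow x α (k + 1) = factPow x α k * (x + (k : ℝ) * α) :=
  Finset.prod_range_succ _ _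

theorem factPow_succ_left (x α : ℝ) (k : ℕ) :
    factPow x α (k + 1) = x * factPow (x + α) α k := by
  simp only [factPow, Finset.prod_range_succ']
  rw [mul_comm]
  congr 1
  · simp
  · refine Finset.prod_congr rfl fun j _ => ?_
    push_cast
    ring

/-- The Chu–Vandermonde identity for factorial powers. -/
theorem sum_choose_mul_factPow_mul_factPow (x y α : ℝ) (n : ℕ) :
    ∑ k ∈ Finset.range (n + 1), (n.choose k : ℝ) * factPow x α k * factPow y α (n - k) =
      factPow (x + y) α n := by
  rw [← Finset.Nat.sum_antidiagonal_eq_sum_range_succ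
    (fun i j => (n.choose i : ℝ) * factPow x α i * factPow y α j) n]
  induction n with
  | zero => simp [factPow]
  | succ n ih =>
    simp only [mul_assoc] at ih ⊢
    rw [Finset.sum_antidiagonal_choose_succ_mul (fun i j => factPow x α i * factPow y α j) n,
      ← Finset.sum_add_distrib, factPow_succ, ← ih, Finset.sum_mul]
    refine Finset.sum_congr rfl fun p hp => ?_
    have hsum : p.1 + p.2 = n := Finset.HasAntidiagonal.mem_antidiagonal.mp hp
    have hcast : (n : ℝ) = p.1 + p.2 := by exact_mod_cast hsum.symm
    rw [← Nat.choose_symm_of_eq_add hsum.symm, factPow_succ, factPow_succ, hcast]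
    ring

/-- The first-moment version of the Chu–Vandermonde identity for factorial powers. -/
theorem sum_mul_choose_mul_factPow_mul_factPow (x y α : ℝ) (n : ℕ) :
    ∑ k ∈ Finset.range (n + 2),
        (k : ℝ) * (((n + 1).choose k : ℝ) * factPow x α k * factPow y α (n + 1 - k)) =
      ((n : ℝ) + 1) * x * factPow (x + α + y) α n := by
  rw [Finset.sum_range_succ', ← sum_choose_mul_factPow_mul_factPow, Finset.mul_sum]
  simp only [Nat.cast_zero, zero_mul, add_zero]
  refine Finset.sum_congr rfl fun k _ => ?_
  have hchoose : ((n : ℝ) + 1) * n.choose k = (n + 1).choose (k + 1) * ((k : ℝ) + 1) := by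
    exact_mod_cast Nat.add_one_mul_choose_eq n k
  rw [factPow_succ_left, Nat.add_sub_add_right]
  push_cast
  linear_combination (-x * factPow (x + α) α k * factPow y α (n - k)) * hchoose

/-- **The Bernstein–Stancu operator is exact on `P₁`.**  For every `n ≥ 1`,
`α ∈ ℝ` and `x ∈ ℝ`:
`Σ_{k=0}^n C(n,k)(x)_α^k(1−x)_α^{n−k} = (1)_α^n`,
`Σ_{k=0}^n k C(n,k)(x)_α^k(1−x)_α^{n−k} = n x (1)_α^n`,
and consequently, when `(1)_α^n ≠ 0`, the Bernstein–Stancu operator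
`S_n^{(α)}` reproduces every affine function. -/
theorem stancu_exact_on_P1 (n : ℕ) (hn : 1 ≤ n) (α : ℝ) :
    (∀ x : ℝ,
      ∑ k ∈ Finset.range (n + 1),
        (n.choose k : ℝ) * factPow x α k * factPow (1 - x) α (n - k) = factPow 1 α n) ∧
    (∀ x : ℝ,
      ∑ k ∈ Finset.range (n + 1),
        (k : ℝ) * ((n.choose k : ℝ) * factPow x α k * factPow (1 - x) α (n - k)) =
          (n : ℝ) * x * factPow 1 α n) ∧
    (factPow 1 α n ≠ 0 →
      ∀ c d x : ℝ,
        ∑ k ∈ Finset.range (n + 1),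
          (c * ((k : ℝ) / (n : ℝ)) + d) * stancuBasis n k α x = c * x + d) := by
  have hzero : ∀ x : ℝ, ∑ k ∈ Finset.range (n + 1),
      (n.choose k : ℝ) * factPow x α k * factPow (1 - x) α (n - k) = factPow 1 α n := by
    intro x
    rw [sum_choose_mul_factPow_mul_factPow, add_sub_cancel]
  have hone : ∀ x : ℝ, ∑ k ∈ Finset.range (n + 1),
      (k : ℝ) * ((n.choose k : ℝ) * factPow x α k * factPow (1 - x) α (n - k)) =
        (n : ℝ) * x * factPow 1 α n := by
    intro x
    obtain ⟨m, rfl⟩ := Nat.exists_eq_add_of_le' hn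
    rw [sum_mul_choose_mul_factPow_mul_factPow, factPow_succ_left 1,
      show x + α + (1 - x) = 1 + α by ring]
    push_cast
    ring
  refine ⟨hzero, hone, fun hne c d x => ?_⟩
  have hn0 : (n : ℝ) ≠ 0 := by exact_mod_cast (by omega : n ≠ 0)
  calc
    _ = c / n / factPow 1 α n * ∑ k ∈ Finset.range (n + 1),
            (k : ℝ) * ((n.choose k : ℝ) * factPow x α k * factPow (1 - x) α (n - k)) +
          d / factPow 1 α n * ∑ k ∈ Finset.range (n + 1),
            (n.choose k : ℝ) * factPow x α k * factPow (1 - x) α (n - k) := by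
      rw [Finset.mul_sum, Finset.mul_sum, ← Finset.sum_add_distrib]
      refine Finset.sum_congr rfl fun k _ => ?_
      rw [stancuBasis]
      ring
    _ = c * x + d := by
      rw [hzero, hone]
      field_simp
end

section
/- Let f : [0,1] → ℝ be twice continuously differentiable. Then for every x ∈ [0,1], the sequence n·(G_n f(x) − f(x)) converges as n → ∞ to x(1−x)·f″(x), where G_n is the Goodman–Sharma operator. -/
open Polynomial intervalIntegral Filter

theorem integral_pow_mul_one_sub_pow (a b : ℕ) :
    ∫ t in (0 : ℝ)..1, t ^ a * (1 - t) ^ b =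
      (a.factorial * b.factorial : ℝ) / (a + b + 1).factorial := by
  induction b generalizing a with
  | zero =>
    have : ((a : ℝ) + 1) ≠ 0 := by positivity
    have : (a.factorial : ℝ) ≠ 0 := by positivity
    simp [integral_pow, Nat.factorial_succ]
    field_simp
  | succ b ih =>
    have hderiv : ∀ t : ℝ, HasDerivAt (fun t : ℝ => t ^ (a + 1) * (1 - t) ^ (b + 1))
        ((a + 1) * (t ^ a * (1 - t) ^ (b + 1)) - (b + 1) * (t ^ (a + 1) * (1 - t) ^ b)) t := by
      intro t
      convert! (hasDerivAt_pow (a + 1) t).mul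
        (((hasDerivAt_id t).const_sub 1).pow (b + 1)) using 1
      simp
      ring
    have hint := integral_eq_sub_of_hasDerivAt (a := 0) (b := 1) (fun t _ => hderiv t)
      (Continuous.intervalIntegrable (by fun_prop) _ _)
    rw [intervalIntegral.integral_sub (Continuous.intervalIntegrable (by fun_prop) _ _)
      (Continuous.intervalIntegrable (by fun_prop) _ _), intervalIntegral.integral_const_mul,
      intervalIntegral.integral_const_mul, ih (a + 1)] at hint
    have ha : ((a : ℝ) + 1) ≠ 0 := by positivity
    apply mul_left_cancel₀ ha
    have h0 : (0 : ℝ) ^ (a + 1) * (1 - 0) ^ (b + 1) = 0 := by simp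
    have h1 : (1 : ℝ) ^ (a + 1) * (1 - 1) ^ (b + 1) = 0 := by simp
    rw [h0, h1, sub_zero, sub_eq_zero] at hint
    rw [hint, show a + (b + 1) + 1 = a + 1 + b + 1 by ring, Nat.factorial_succ a,
      Nat.factorial_succ b]
    push_cast
    ring

theorem eval_bernsteinPolynomial (n i : ℕ) (x : ℝ) :
    (bernsteinPolynomial ℝ n i).eval x = n.choose i * x ^ i * (1 - x) ^ (n - i) := by
  simp [bernsteinPolynomial]

theorem integral_pow_mul_bernsteinPolynomial {m j : ℕ} (hj : j ≤ m) (k : ℕ) :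
    (m + 1) * ∫ t in (0 : ℝ)..1, t ^ k * (bernsteinPolynomial ℝ m j).eval t =
      ((j + 1).ascFactorial k : ℝ) / (m + 2).ascFactorial k := by
  have hfun : ∀ t : ℝ, t ^ k * (bernsteinPolynomial ℝ m j).eval t =
      m.choose j * (t ^ (j + k) * (1 - t) ^ (m - j)) := by
    intro t
    rw [eval_bernsteinPolynomial]
    ring
  simp only [hfun]
  rw [intervalIntegral.integral_const_mul, integral_pow_mul_one_sub_pow,
    show j + k + (m - j) + 1 = m + 1 + k by omega, ← Nat.factorial_mul_ascFactorial (m + 1) k,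
    ← Nat.factorial_mul_ascFactorial j k, Nat.factorial_succ,
    ← Nat.choose_mul_factorial_mul_factorial hj]
  have h1 : (j.factorial : ℝ) ≠ 0 := by positivity
  have h2 : ((m - j).factorial : ℝ) ≠ 0 := by positivity
  have h3 : (m.choose j : ℝ) ≠ 0 := by
    exact_mod_cast (Nat.choose_pos hj).ne'
  have h4 : ((m : ℝ) + 1) ≠ 0 := by positivity
  have h5 : ((m + 2).ascFactorial k : ℝ) ≠ 0 := by
    exact_mod_cast (Nat.pos_of_ne_zero (by positivity)).ne'
  push_cast
  field_simp

/-- The factorial moments of the binomial distribution. -/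
theorem sum_prod_sub_mul_bernsteinPolynomial (n k : ℕ) (x : ℝ) :
    ∑ i ∈ Finset.range (n + 1),
        (∏ l ∈ Finset.range k, ((i : ℝ) - l)) * (bernsteinPolynomial ℝ n i).eval x =
      (∏ l ∈ Finset.range k, ((n : ℝ) - l)) * x ^ k := by
  induction k generalizing n with
  | zero => simpa [eval_finsetSum] using congrArg (eval x) (bernsteinPolynomial.sum ℝ n)
  | succ k ih =>
    cases n with
    | zero => simp [Finset.prod_range_succ']
    | succ n =>
      have hstep : ∀ i : ℕ, ∏ l ∈ Finset.range (k + 1), (((i + 1 : ℕ) : ℝ) - l) =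
          (i + 1) * ∏ l ∈ Finset.range k, ((i : ℝ) - l) := by
        intro i
        rw [Finset.prod_range_succ', mul_comm]
        simp
      rw [Finset.sum_range_succ', hstep n]
      have hzero : ∏ l ∈ Finset.range (k + 1), (((0 : ℕ) : ℝ) - l) = 0 := by
        simp [Finset.prod_range_succ']
      rw [hzero, zero_mul, add_zero, pow_succ, mul_assoc, ← mul_assoc _ _ x, ← ih n,
        Finset.sum_mul, Finset.mul_sum]
      refine Finset.sum_congr rfl fun i _ => ?_
      have hchoose : ((n : ℝ) + 1) * n.choose i = (n + 1).choose (i + 1) * (i + 1) := by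
        exact_mod_cast Nat.add_one_mul_choose_eq n i
      rw [hstep, eval_bernsteinPolynomial, eval_bernsteinPolynomial, Nat.add_sub_add_right]
      linear_combination (-(∏ l ∈ Finset.range k, ((i : ℝ) - l)) * x ^ (i + 1) *
        (1 - x) ^ (n - i)) * hchoose

/-- The kernel of the integral part of the Goodman–Sharma operator of degree `m + 2`. -/
noncomputable def goodmanSharmaKernel (m : ℕ) (x t : ℝ) : ℝ :=
  (m + 1) * ∑ j ∈ Finset.range (m + 1),
    (bernsteinPolynomial ℝ m j).eval t * (bernsteinPolynomial ℝ (m + 2) (j + 1)).eval x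

/-- The Goodman–Sharma operator of degree `m + 2`, written with endpoint evaluations and
a nonnegative kernel. -/
noncomputable def goodmanSharmaKernelForm (m : ℕ) (x : ℝ) (h : ℝ → ℝ) : ℝ :=
  h 0 * (1 - x) ^ (m + 2) + h 1 * x ^ (m + 2) +
    ∫ t in (0 : ℝ)..1, h t * goodmanSharmaKernel m x t

@[fun_prop]
theorem continuous_goodmanSharmaKernel (m : ℕ) (x : ℝ) :
    Continuous (goodmanSharmaKernel m x) := by
  unfold goodmanSharmaKernel
  fun_prop

theorem eval_bernsteinPolynomial_nonneg_s13 (n i : ℕ) {x : ℝ} (hx : x ∈ Set.Icc (0 : ℝ) 1) :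
    0 ≤ (bernsteinPolynomial ℝ n i).eval x := by
  have h0 := hx.1
  have h1 := sub_nonneg.2 hx.2
  rw [eval_bernsteinPolynomial]
  positivity

theorem goodmanSharmaKernel_nonneg (m : ℕ) {x t : ℝ} (hx : x ∈ Set.Icc (0 : ℝ) 1)
    (ht : t ∈ Set.Icc (0 : ℝ) 1) : 0 ≤ goodmanSharmaKernel m x t :=
  mul_nonneg (by positivity) <| Finset.sum_nonneg fun j _ =>
    mul_nonneg (eval_bernsteinPolynomial_nonneg_s13 m j ht) (eval_bernsteinPolynomial_nonneg_s13 _ _ hx)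

theorem intervalIntegrable_mul_goodmanSharmaKernel (m : ℕ) (x : ℝ) {h : ℝ → ℝ}
    (hh : ContinuousOn h (Set.Icc 0 1)) :
    IntervalIntegrable (fun t => h t * goodmanSharmaKernel m x t) MeasureTheory.volume 0 1 := by
  apply ContinuousOn.intervalIntegrable
  rw [Set.uIcc_of_le zero_le_one]
  exact hh.mul (continuous_goodmanSharmaKernel m x).continuousOn

theorem goodmanSharmaKernelForm_add (m : ℕ) (x : ℝ) {h g : ℝ → ℝ}
    (hh : ContinuousOn h (Set.Icc 0 1)) (hg : ContinuousOn g (Set.Icc 0 1)) :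
    goodmanSharmaKernelForm m x (fun t => h t + g t) =
      goodmanSharmaKernelForm m x h + goodmanSharmaKernelForm m x g := by
  simp only [goodmanSharmaKernelForm, add_mul]
  rw [intervalIntegral.integral_add (intervalIntegrable_mul_goodmanSharmaKernel m x hh)
    (intervalIntegrable_mul_goodmanSharmaKernel m x hg)]
  ring

theorem goodmanSharmaKernelForm_const_mul (m : ℕ) (x c : ℝ) (h : ℝ → ℝ) :
    goodmanSharmaKernelForm m x (fun t => c * h t) = c * goodmanSharmaKernelForm m x h := by
  simp only [goodmanSharmaKernelForm, mul_assoc, intervalIntegral.integral_const_mul]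
  ring

theorem goodmanSharmaKernelForm_mono (m : ℕ) {x : ℝ} (hx : x ∈ Set.Icc (0 : ℝ) 1) {h g : ℝ → ℝ}
    (hh : ContinuousOn h (Set.Icc 0 1)) (hg : ContinuousOn g (Set.Icc 0 1))
    (hle : ∀ t ∈ Set.Icc (0 : ℝ) 1, h t ≤ g t) :
    goodmanSharmaKernelForm m x h ≤ goodmanSharmaKernelForm m x g := by
  have h0 := hx.1
  have h1 := sub_nonneg.2 hx.2
  refine add_le_add (add_le_add ?_ ?_) ?_
  · exact mul_le_mul_of_nonneg_right (hle 0 (by simp)) (by positivity)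
  · exact mul_le_mul_of_nonneg_right (hle 1 (by simp)) (by positivity)
  · exact intervalIntegral.integral_mono_on zero_le_one
      (intervalIntegrable_mul_goodmanSharmaKernel m x hh)
      (intervalIntegrable_mul_goodmanSharmaKernel m x hg)
      fun t ht => mul_le_mul_of_nonneg_right (hle t ht) (goodmanSharmaKernel_nonneg m hx ht)

theorem integral_mul_goodmanSharmaKernel (m : ℕ) (x : ℝ) {h : ℝ → ℝ}
    (hh : ContinuousOn h (Set.Icc 0 1)) :
    ∫ t in (0 : ℝ)..1, h t * goodmanSharmaKernel m x t =
      (m + 1) * ∑ j ∈ Finset.range (m + 1),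
        (∫ t in (0 : ℝ)..1, h t * (bernsteinPolynomial ℝ m j).eval t) *
          (bernsteinPolynomial ℝ (m + 2) (j + 1)).eval x := by
  have hfun : ∀ t, h t * goodmanSharmaKernel m x t =
      (m + 1) * ∑ j ∈ Finset.range (m + 1), (h t * (bernsteinPolynomial ℝ m j).eval t) *
        (bernsteinPolynomial ℝ (m + 2) (j + 1)).eval x := by
    intro t
    rw [goodmanSharmaKernel, mul_left_comm, Finset.mul_sum]
    simp only [mul_assoc]
  simp only [hfun]
  rw [intervalIntegral.integral_const_mul, intervalIntegral.integral_finsetSum]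
  · simp only [intervalIntegral.integral_mul_const]
  · intro j _
    apply ContinuousOn.intervalIntegrable
    rw [Set.uIcc_of_le zero_le_one]
    fun_prop

theorem goodmanSharmaKernelForm_pow (m k : ℕ) (x : ℝ) :
    goodmanSharmaKernelForm m x (fun t => t ^ k) =
      (∑ i ∈ Finset.range (m + 3),
        (i.ascFactorial k : ℝ) * (bernsteinPolynomial ℝ (m + 2) i).eval x) /
          (m + 2).ascFactorial k := by
  have hpos : ((m + 2).ascFactorial k : ℝ) ≠ 0 := by
    exact_mod_cast (Nat.pos_of_ne_zero (by positivity)).ne'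
  have hzero : (0 : ℝ) ^ k = (Nat.ascFactorial 0 k : ℝ) / (m + 2).ascFactorial k := by
    cases k <;> simp [Nat.zero_ascFactorial]
  rw [goodmanSharmaKernelForm, integral_mul_goodmanSharmaKernel m x (by fun_prop),
    Finset.sum_range_succ' _ (m + 2), Finset.sum_range_succ _ (m + 1), Finset.mul_sum, hzero, add_div, add_div,
    Finset.sum_div]
  have hsum : ∀ j ∈ Finset.range (m + 1),
      ((m : ℝ) + 1) * ((∫ t in (0 : ℝ)..1, t ^ k * (bernsteinPolynomial ℝ m j).eval t) *
        (bernsteinPolynomial ℝ (m + 2) (j + 1)).eval x) =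
      ((j + 1).ascFactorial k : ℝ) * (bernsteinPolynomial ℝ (m + 2) (j + 1)).eval x /
        (m + 2).ascFactorial k := by
    intro j hj
    rw [← mul_assoc, integral_pow_mul_bernsteinPolynomial (Finset.mem_range_succ_iff.1 hj)]
    ring
  rw [Finset.sum_congr rfl hsum]
  simp only [eval_bernsteinPolynomial]
  simp
  field_simp
  ring

theorem goodmanSharmaKernelForm_pow_zero (m : ℕ) (x : ℝ) :
    goodmanSharmaKernelForm m x (fun t => t ^ 0) = 1 := by
  have h := sum_prod_sub_mul_bernsteinPolynomial (m + 2) 0 x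
  rw [goodmanSharmaKernelForm_pow]
  simpa using h

theorem goodmanSharmaKernelForm_pow_one (m : ℕ) (x : ℝ) :
    goodmanSharmaKernelForm m x (fun t => t ^ 1) = x := by
  have h1 := sum_prod_sub_mul_bernsteinPolynomial (m + 2) 1 x
  have hm : (m : ℝ) + 2 ≠ 0 := by positivity
  simp only [Finset.prod_range_succ, Finset.prod_range_zero] at h1
  rw [goodmanSharmaKernelForm_pow, div_eq_iff (by simpa [Nat.ascFactorial] using hm)]
  simp only [Nat.ascFactorial]
  push_cast at h1 ⊢
  convert! h1 using 1
  · exact Finset.sum_congr rfl fun i _ => by ring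
  · ring

theorem goodmanSharmaKernelForm_pow_two (m : ℕ) (x : ℝ) :
    goodmanSharmaKernelForm m x (fun t => t ^ 2) = ((m + 1) * x ^ 2 + 2 * x) / (m + 3) := by
  have h1 := sum_prod_sub_mul_bernsteinPolynomial (m + 2) 1 x
  have h2 := sum_prod_sub_mul_bernsteinPolynomial (m + 2) 2 x
  simp only [Finset.prod_range_succ, Finset.prod_range_zero] at h1 h2
  have hsum : ∑ i ∈ Finset.range (m + 3),
      (i.ascFactorial 2 : ℝ) * (bernsteinPolynomial ℝ (m + 2) i).eval x =
      (m + 2) * ((m + 1) * x ^ 2 + 2 * x) := by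
    push_cast at h1 h2
    refine Eq.trans ?_ ((congrArg₂ (· + ·) h2 (congrArg (2 * ·) h1)).trans (by ring))
    simp only [Finset.mul_sum, ← Finset.sum_add_distrib]
    refine Finset.sum_congr rfl fun i _ => ?_
    simp only [Nat.ascFactorial]
    push_cast
    ring
  rw [goodmanSharmaKernelForm_pow, hsum]
  simp only [Nat.ascFactorial]
  push_cast
  rw [div_eq_div_iff (by positivity) (by positivity)]
  ring

theorem goodmanSharmaKernelForm_pow_three (m : ℕ) (x : ℝ) :
    goodmanSharmaKernelForm m x (fun t => t ^ 3) =
      ((m + 1) * m * x ^ 3 + 6 * (m + 1) * x ^ 2 + 6 * x) / ((m + 3) * (m + 4)) := by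
  have h1 := sum_prod_sub_mul_bernsteinPolynomial (m + 2) 1 x
  have h2 := sum_prod_sub_mul_bernsteinPolynomial (m + 2) 2 x
  have h3 := sum_prod_sub_mul_bernsteinPolynomial (m + 2) 3 x
  simp only [Finset.prod_range_succ, Finset.prod_range_zero] at h1 h2 h3
  have hsum : ∑ i ∈ Finset.range (m + 3),
      (i.ascFactorial 3 : ℝ) * (bernsteinPolynomial ℝ (m + 2) i).eval x =
      (m + 2) * ((m + 1) * m * x ^ 3 + 6 * (m + 1) * x ^ 2 + 6 * x) := by
    push_cast at h1 h2 h3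
    refine Eq.trans ?_ ((congrArg₂ (· + ·) h3 (congrArg₂ (· + ·) (congrArg (6 * ·) h2)
      (congrArg (6 * ·) h1))).trans (by ring))
    simp only [Finset.mul_sum, ← Finset.sum_add_distrib]
    refine Finset.sum_congr rfl fun i _ => ?_
    simp only [Nat.ascFactorial]
    push_cast
    ring
  rw [goodmanSharmaKernelForm_pow, hsum]
  simp only [Nat.ascFactorial]
  push_cast
  rw [div_eq_div_iff (by positivity) (by positivity)]
  ring

theorem goodmanSharmaKernelForm_pow_four (m : ℕ) (x : ℝ) :
    goodmanSharmaKernelForm m x (fun t => t ^ 4) =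
      ((m + 1) * m * (m - 1) * x ^ 4 + 12 * (m + 1) * m * x ^ 3 + 36 * (m + 1) * x ^ 2 + 24 * x) /
        ((m + 3) * (m + 4) * (m + 5)) := by
  have h1 := sum_prod_sub_mul_bernsteinPolynomial (m + 2) 1 x
  have h2 := sum_prod_sub_mul_bernsteinPolynomial (m + 2) 2 x
  have h3 := sum_prod_sub_mul_bernsteinPolynomial (m + 2) 3 x
  have h4 := sum_prod_sub_mul_bernsteinPolynomial (m + 2) 4 x
  simp only [Finset.prod_range_succ, Finset.prod_range_zero] at h1 h2 h3 h4
  have hsum : ∑ i ∈ Finset.range (m + 3),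
      (i.ascFactorial 4 : ℝ) * (bernsteinPolynomial ℝ (m + 2) i).eval x =
      (m + 2) * ((m + 1) * m * (m - 1) * x ^ 4 + 12 * (m + 1) * m * x ^ 3 +
        36 * (m + 1) * x ^ 2 + 24 * x) := by
    push_cast at h1 h2 h3 h4
    refine Eq.trans ?_ ((congrArg₂ (· + ·) h4 (congrArg₂ (· + ·) (congrArg (12 * ·) h3)
      (congrArg₂ (· + ·) (congrArg (36 * ·) h2) (congrArg (24 * ·) h1)))).trans (by ring))
    simp only [Finset.mul_sum, ← Finset.sum_add_distrib]
    refine Finset.sum_congr rfl fun i _ => ?_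
    simp only [Nat.ascFactorial]
    push_cast
    ring
  rw [goodmanSharmaKernelForm_pow, hsum]
  simp only [Nat.ascFactorial]
  push_cast
  rw [div_eq_div_iff (by positivity) (by positivity)]
  ring

theorem goodmanSharmaKernelForm_polynomial (m N : ℕ) (x : ℝ) (c : ℕ → ℝ) :
    goodmanSharmaKernelForm m x (fun t => ∑ k ∈ Finset.range N, c k * t ^ k) =
      ∑ k ∈ Finset.range N, c k * goodmanSharmaKernelForm m x (fun t => t ^ k) := by
  induction N with
  | zero => simp [goodmanSharmaKernelForm]
  | succ N ih =>
    simp only [Finset.sum_range_succ]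
    rw [goodmanSharmaKernelForm_add m x (by fun_prop) (by fun_prop), ih,
      goodmanSharmaKernelForm_const_mul]

theorem goodmanSharmaKernelForm_affine (m : ℕ) (x a b : ℝ) :
    goodmanSharmaKernelForm m x (fun t => a + b * t) = a + b * x := by
  have h := goodmanSharmaKernelForm_polynomial m 2 x fun k => if k = 0 then a else b
  simp only [Finset.sum_range_succ, Finset.sum_range_zero, goodmanSharmaKernelForm_pow_zero,
    goodmanSharmaKernelForm_pow_one] at h
  simpa using h

theorem goodmanSharmaKernelForm_sub_sq (m : ℕ) (x : ℝ) :
    goodmanSharmaKernelForm m x (fun t => (t - x) ^ 2) = 2 * (x * (1 - x)) / (m + 3) := by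
  have h := goodmanSharmaKernelForm_polynomial m 3 x
    fun k => (-x) ^ (2 - k) * (Nat.choose 2 k : ℝ)
  have hfun : ∀ t : ℝ, ∑ k ∈ Finset.range 3, (-x) ^ (2 - k) * (Nat.choose 2 k : ℝ) * t ^ k =
      (t - x) ^ 2 := by
    intro t
    simp [Finset.sum_range_succ, Nat.choose]
    ring
  simp only [hfun] at h
  rw [h]
  simp only [Finset.sum_range_succ, Finset.sum_range_zero, goodmanSharmaKernelForm_pow_zero,
    goodmanSharmaKernelForm_pow_one, goodmanSharmaKernelForm_pow_two]
  have hm : (m : ℝ) + 3 ≠ 0 := by positivity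
  simp [Nat.choose]
  field_simp
  ring

theorem goodmanSharmaKernelForm_sub_pow_four (m : ℕ) (x : ℝ) :
    goodmanSharmaKernelForm m x (fun t => (t - x) ^ 4) =
      12 * (x * (1 - x)) * ((m - 5) * (x * (1 - x)) + 2) / ((m + 3) * (m + 4) * (m + 5)) := by
  have h := goodmanSharmaKernelForm_polynomial m 5 x
    fun k => (-x) ^ (4 - k) * (Nat.choose 4 k : ℝ)
  have hfun : ∀ t : ℝ, ∑ k ∈ Finset.range 5, (-x) ^ (4 - k) * (Nat.choose 4 k : ℝ) * t ^ k =
      (t - x) ^ 4 := by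
    intro t
    simp [Finset.sum_range_succ, Nat.choose]
    ring
  simp only [hfun] at h
  rw [h]
  simp only [Finset.sum_range_succ, Finset.sum_range_zero, goodmanSharmaKernelForm_pow_zero,
    goodmanSharmaKernelForm_pow_one, goodmanSharmaKernelForm_pow_two,
    goodmanSharmaKernelForm_pow_three, goodmanSharmaKernelForm_pow_four]
  have h3 : (m : ℝ) + 3 ≠ 0 := by positivity
  have h4 : (m : ℝ) + 4 ≠ 0 := by positivity
  have h5 : (m : ℝ) + 5 ≠ 0 := by positivity
  simp [Nat.choose]
  field_simp
  ring

theorem goodmanSharma_eq_kernelForm (m : ℕ) (x : ℝ) {f : ℝ → ℝ}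
    (hf : ContinuousOn f (Set.Icc 0 1)) :
    goodmanSharma (m + 2) f x = goodmanSharmaKernelForm m x f := by
  have hcont : ContinuousOn (fun t => f t - ((1 - t) * f 0 + t * f 1)) (Set.Icc 0 1) := by
    fun_prop
  have hsplit : f = fun t => (f t - ((1 - t) * f 0 + t * f 1)) + (f 0 + (f 1 - f 0) * t) := by
    funext t
    ring
  conv_rhs => rw [hsplit]
  rw [goodmanSharmaKernelForm_add m x hcont (by fun_prop), goodmanSharmaKernelForm_affine,
    goodmanSharmaKernelForm, integral_mul_goodmanSharmaKernel m x hcont, goodmanSharma,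
    show Finset.Icc 1 (m + 2 - 1) = Finset.Ico 1 (m + 2) by ext; simp; omega,
    Finset.sum_Ico_eq_sum_range]
  simp only [Nat.add_sub_cancel, add_comm 1,
    show m + 2 - 1 = m + 1 by omega]
  push_cast
  ring

theorem taylorWithinEval_two (f : ℝ → ℝ) (s : Set ℝ) (x t : ℝ) :
    taylorWithinEval f 2 s x t = (f x + iteratedDerivWithin 1 f s x * (t - x)) +
      iteratedDerivWithin 2 f s x / 2 * (t - x) ^ 2 := by
  simp [taylorWithinEval_succ, -iteratedDerivWithin_one]
  ring

theorem continuousOn_sub_taylorWithinEval_two {f : ℝ → ℝ} {s : Set ℝ} (hf : ContinuousOn f s)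
    (x : ℝ) : ContinuousOn (fun t => f t - taylorWithinEval f 2 s x t) s := by
  simp only [taylorWithinEval_two]
  fun_prop

theorem exists_abs_taylor_remainder_le {f : ℝ → ℝ} (hf : ContDiffOn ℝ 2 f (Set.Icc 0 1)) {x : ℝ}
    (hx : x ∈ Set.Icc (0 : ℝ) 1) {ε : ℝ} (hε : 0 < ε) :
    ∃ C, 0 ≤ C ∧ ∀ t ∈ Set.Icc (0 : ℝ) 1,
      |f t - taylorWithinEval f 2 (Set.Icc 0 1) x t| ≤ ε * (t - x) ^ 2 + C * (t - x) ^ 4 := by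
  have ho := (taylor_isLittleO (convex_Icc (0 : ℝ) 1) hx hf).def hε
  obtain ⟨δ, hδ, hball⟩ := Metric.mem_nhdsWithin_iff.1 ho
  have hcont := continuousOn_sub_taylorWithinEval_two hf.continuousOn x
  obtain ⟨M, hM⟩ := isCompact_Icc.exists_bound_of_continuousOn hcont
  have hM0 : 0 ≤ M := (norm_nonneg _).trans (hM x hx)
  refine ⟨M / δ ^ 4, by positivity, fun t ht => ?_⟩
  rcases lt_or_ge |t - x| δ with hlt | hge
  · have h := hball ⟨by simpa [Real.dist_eq] using hlt, ht⟩
    simp only [Set.mem_ofPred_eq, Real.norm_eq_abs, abs_of_nonneg (sq_nonneg (t - x))] at h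
    exact h.trans (le_add_of_nonneg_right (by positivity))
  · have hpow : δ ^ 4 ≤ (t - x) ^ 4 := by
      rw [← Even.pow_abs (by decide) (t - x)]
      gcongr
    calc |f t - taylorWithinEval f 2 (Set.Icc 0 1) x t| ≤ M := hM t ht
      _ = M / δ ^ 4 * δ ^ 4 := by field_simp
      _ ≤ M / δ ^ 4 * (t - x) ^ 4 := by gcongr
      _ ≤ _ := le_add_of_nonneg_left (by positivity)

theorem abs_goodmanSharmaKernelForm_le (m : ℕ) {x : ℝ} (hx : x ∈ Set.Icc (0 : ℝ) 1)
    {h g : ℝ → ℝ} (hh : ContinuousOn h (Set.Icc 0 1)) (hg : ContinuousOn g (Set.Icc 0 1))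
    (hle : ∀ t ∈ Set.Icc (0 : ℝ) 1, |h t| ≤ g t) :
    |goodmanSharmaKernelForm m x h| ≤ goodmanSharmaKernelForm m x g := by
  refine abs_le.2 ⟨?_, goodmanSharmaKernelForm_mono m hx hh hg fun t ht =>
    (le_abs_self _).trans (hle t ht)⟩
  have hneg := goodmanSharmaKernelForm_mono m hx (h := fun t => -1 * g t) (by fun_prop) hh
    fun t ht => by linarith [neg_abs_le (h t), hle t ht]
  rw [goodmanSharmaKernelForm_const_mul] at hneg
  linarith

theorem tendsto_mul_goodmanSharmaKernelForm_taylor_remainder {f : ℝ → ℝ}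
    (hf : ContDiffOn ℝ 2 f (Set.Icc 0 1)) {x : ℝ} (hx : x ∈ Set.Icc (0 : ℝ) 1) :
    Tendsto (fun m : ℕ => ((m : ℝ) + 2) * goodmanSharmaKernelForm m x
      (fun t => f t - taylorWithinEval f 2 (Set.Icc 0 1) x t)) atTop (nhds 0) := by
  have hX0 : 0 ≤ x * (1 - x) := mul_nonneg hx.1 (sub_nonneg.2 hx.2)
  have hX1 : x * (1 - x) ≤ 1 := by nlinarith [hx.1, hx.2]
  have hcont := continuousOn_sub_taylorWithinEval_two hf.continuousOn x
  rw [Metric.tendsto_atTop']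
  intro ε hε
  obtain ⟨C, hC, hbound⟩ := exists_abs_taylor_remainder_le hf hx (ε := ε / 4) (by positivity)
  obtain ⟨N, hN⟩ := exists_nat_gt (24 * C / ε)
  refine ⟨N, fun m hm => ?_⟩
  have hmN : (N : ℝ) ≤ m := by exact_mod_cast hm.le
  have hm0 : (0 : ℝ) ≤ m := m.cast_nonneg
  have habs := abs_goodmanSharmaKernelForm_le m hx hcont (by fun_prop) hbound
  rw [goodmanSharmaKernelForm_add m x (by fun_prop) (by fun_prop),
    goodmanSharmaKernelForm_const_mul, goodmanSharmaKernelForm_const_mul,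
    goodmanSharmaKernelForm_sub_sq, goodmanSharmaKernelForm_sub_pow_four] at habs
  have hsq : ((m : ℝ) + 2) * (2 * (x * (1 - x)) / (m + 3)) ≤ 2 := by
    rw [← mul_div_assoc, div_le_iff₀ (by positivity)]
    nlinarith
  have hfour : ((m : ℝ) + 2) * (12 * (x * (1 - x)) * ((m - 5) * (x * (1 - x)) + 2) /
      ((m + 3) * (m + 4) * (m + 5))) ≤ 12 / (m + 3) := by
    have hlin : (m - 5) * (x * (1 - x)) + 2 ≤ (m : ℝ) + 4 := by nlinarith
    have hprod : (x * (1 - x)) * ((m - 5) * (x * (1 - x)) + 2) ≤ (m : ℝ) + 4 :=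
      (mul_le_mul_of_nonneg_left hlin hX0).trans (mul_le_of_le_one_left (by positivity) hX1)
    rw [← mul_div_assoc, div_le_div_iff₀ (by positivity) (by positivity)]
    calc ((m : ℝ) + 2) * (12 * (x * (1 - x)) * ((m - 5) * (x * (1 - x)) + 2)) * (m + 3)
        = 12 * (m + 2) * (m + 3) * ((x * (1 - x)) * ((m - 5) * (x * (1 - x)) + 2)) := by ring
      _ ≤ 12 * (m + 2) * (m + 3) * (m + 4) := by gcongr
      _ ≤ 12 * (m + 5) * (m + 3) * (m + 4) := by gcongr; norm_num
      _ = 12 * ((m + 3) * (m + 4) * (m + 5)) := by ring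
  have hsmall : C * (12 / ((m : ℝ) + 3)) < ε / 2 := by
    rw [div_lt_iff₀ hε] at hN
    rw [← mul_div_assoc, div_lt_iff₀ (by positivity)]
    nlinarith
  rw [dist_zero_right, Real.norm_eq_abs, abs_mul, abs_of_pos (by positivity)]
  have h1 := mul_le_mul_of_nonneg_left habs (show (0 : ℝ) ≤ m + 2 by positivity)
  have h2 := mul_le_mul_of_nonneg_left hsq (show 0 ≤ ε / 4 by positivity)
  have h3 := mul_le_mul_of_nonneg_left hfour hC
  linarith

/-- **Voronovskaja-type theorem for the Goodman–Sharma operator.**  If `f` is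
twice continuously differentiable on `[0,1]`, then for every `x ∈ [0,1]`,
`n (G_n f(x) − f(x)) → x(1−x) f″(x)` as `n → ∞`. -/
theorem goodmanSharma_voronovskaja (f : ℝ → ℝ)
    (hf : ContDiffOn ℝ 2 f (Set.Icc 0 1)) :
    ∀ x ∈ Set.Icc (0 : ℝ) 1,
      Tendsto (fun n : ℕ => (n : ℝ) * (goodmanSharma n f x - f x)) atTop
        (nhds (x * (1 - x) * iteratedDerivWithin 2 f (Set.Icc 0 1) x)) := by
  intro x hx
  rw [← tendsto_add_atTop_iff_nat 2]
  have hf0 := hf.continuousOn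
  set c := iteratedDerivWithin 2 f (Set.Icc 0 1) x
  have hform : ∀ m : ℕ, ((m + 2 : ℕ) : ℝ) * (goodmanSharma (m + 2) f x - f x) =
      x * (1 - x) * c * (((m : ℝ) + 2) / (m + 3)) +
        ((m : ℝ) + 2) * goodmanSharmaKernelForm m x
          (fun t => f t - taylorWithinEval f 2 (Set.Icc 0 1) x t) := by
    intro m
    have hsplit : f = fun t => (f t - taylorWithinEval f 2 (Set.Icc 0 1) x t) +
        ((f x - iteratedDerivWithin 1 f (Set.Icc 0 1) x * x +
          iteratedDerivWithin 1 f (Set.Icc 0 1) x * t) + c / 2 * (t - x) ^ 2) := by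
      funext t
      rw [taylorWithinEval_two]
      ring
    have hval : goodmanSharmaKernelForm m x f = goodmanSharmaKernelForm m x
        (fun t => f t - taylorWithinEval f 2 (Set.Icc 0 1) x t) +
          (f x + c / 2 * (2 * (x * (1 - x)) / (m + 3))) := by
      conv_lhs => rw [hsplit]
      rw [goodmanSharmaKernelForm_add m x (continuousOn_sub_taylorWithinEval_two hf0 x)
          (by fun_prop),
        goodmanSharmaKernelForm_add m x (by fun_prop) (by fun_prop),
        goodmanSharmaKernelForm_affine, goodmanSharmaKernelForm_const_mul,
        goodmanSharmaKernelForm_sub_sq]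
      ring
    rw [goodmanSharma_eq_kernelForm m x hf0, hval]
    push_cast
    ring
  simp only [hform]
  have hratio : Tendsto (fun m : ℕ => ((m : ℝ) + 2) / (m + 3)) atTop (nhds 1) := by
    have h := (tendsto_add_atTop_iff_nat 2).2 (tendsto_natCast_div_add_atTop (1 : ℝ))
    convert! h using 2 with m
    push_cast
    ring
  simpa using (hratio.const_mul (x * (1 - x) * c)).add
    (tendsto_mul_goodmanSharmaKernelForm_taylor_remainder hf hx)
end

section
/- For every integer n ≥ 0, the Durrmeyer operator M_n, defined on polynomials by M_n p = Σ_{i=0}^{n} (n+1)·(∫₀¹ p(t)·b_i^{(n)}(t) dt)·b_i^{(n)}, maps the space of real polynomials of degree at most n bijectively onto itself; that is, the restriction of M_n to P_n is a linear isomorphism. -/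
open Polynomial intervalIntegral

theorem bernsteinPolynomial_mem_degreeLT {R : Type*} [CommRing R] {n i : ℕ} (hi : i ≤ n) :
    bernsteinPolynomial R n i ∈ degreeLT R (n + 1) := by
  rw [mem_degreeLT]
  refine (degree_le_of_natDegree_le ?_).trans_lt (Nat.cast_lt.2 n.lt_succ_self)
  rw [bernsteinPolynomial]
  have h : (1 - X : R[X]).natDegree ≤ 1 := by compute_degree
  calc _ ≤ 0 + i + (n - i) * 1 :=
        natDegree_mul_le_of_le
          (natDegree_mul_le_of_le (natDegree_natCast _).le (natDegree_X_pow_le i))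
          (natDegree_pow_le_of_le _ h)
    _ = n := by omega

theorem X_pow_mul_one_sub_X_pow_mem_span_bernsteinPolynomial {K : Type*} [Field K] [CharZero K]
    {n i : ℕ} (hi : i ≤ n) :
    (X ^ i * (1 - X) ^ (n - i) : K[X]) ∈
      Submodule.span K (Set.range fun j : Fin (n + 1) => bernsteinPolynomial K n j) := by
  have hc : ((n.choose i : ℕ) : K) ≠ 0 := Nat.cast_ne_zero.2 (Nat.choose_pos hi).ne'
  have h : (X ^ i * (1 - X) ^ (n - i) : K[X]) =
      ((n.choose i : ℕ) : K)⁻¹ • bernsteinPolynomial K n i := by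
    rw [bernsteinPolynomial, eq_inv_smul_iff₀ hc, smul_eq_C_mul, map_natCast, mul_assoc]
  rw [h]
  exact Submodule.smul_mem _ _ (Submodule.subset_span ⟨⟨i, Nat.lt_succ_of_le hi⟩, rfl⟩)

theorem span_bernsteinPolynomial (K : Type*) [Field K] [CharZero K] (n : ℕ) :
    Submodule.span K (Set.range fun i : Fin (n + 1) => bernsteinPolynomial K n i) =
      degreeLT K (n + 1) := by
  classical
  refine le_antisymm (Submodule.span_le.2 ?_) ?_
  · rintro _ ⟨i, rfl⟩
    exact bernsteinPolynomial_mem_degreeLT (Nat.lt_succ_iff.1 i.2)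
  · rw [degreeLT_eq_span_X_pow, Submodule.span_le]
    intro p hp
    obtain ⟨k, hk, rfl⟩ := Finset.mem_image.1 (Finset.mem_coe.1 hp)
    have hkn : k ≤ n := Nat.lt_succ_iff.1 (Finset.mem_range.1 hk)
    have h : (X ^ k : K[X]) = ∑ j ∈ Finset.range (n - k + 1),
        (((n - k).choose j : ℕ) : K) • (X ^ (k + j) * (1 - X) ^ (n - (k + j))) := by
      calc (X ^ k : K[X]) = X ^ k * (X + (1 - X)) ^ (n - k) := by simp
        _ = _ := by
          rw [add_pow, Finset.mul_sum]
          refine Finset.sum_congr rfl fun j _ => ?_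
          rw [smul_eq_C_mul, map_natCast, pow_add, Nat.sub_add_eq]
          ring
    rw [SetLike.mem_coe, h]
    refine Submodule.sum_mem _ fun j hj => Submodule.smul_mem _ _
      (X_pow_mul_one_sub_X_pow_mem_span_bernsteinPolynomial ?_)
    have := Finset.mem_range.1 hj
    omega

theorem linearIndependent_bernsteinPolynomial (K : Type*) [Field K] [CharZero K] (n : ℕ) :
    LinearIndependent K fun i : Fin (n + 1) => bernsteinPolynomial K n i := by
  rw [linearIndependent_iff_card_eq_finrank_span, Set.finrank, span_bernsteinPolynomial,
    (degreeLTEquiv K (n + 1)).finrank_eq, Module.finrank_fin_fun, Fintype.card_fin]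

/-- The bilinear form `(p, q) ↦ ∫₀¹ p q` on real polynomials. -/
noncomputable def unitIntervalForm : ℝ[X] →ₗ[ℝ] ℝ[X] →ₗ[ℝ] ℝ :=
  LinearMap.mk₂ ℝ (fun p q => ∫ t in (0 : ℝ)..1, p.eval t * q.eval t)
    (fun p p' q => by
      simp only [eval_add, add_mul]
      exact integral_add (Continuous.intervalIntegrable (by fun_prop) _ _)
        (Continuous.intervalIntegrable (by fun_prop) _ _))
    (fun c p q => by simp only [eval_smul, smul_eq_mul, mul_assoc, integral_const_mul])
    (fun p q q' => by
      simp only [eval_add, mul_add]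
      exact integral_add (Continuous.intervalIntegrable (by fun_prop) _ _)
        (Continuous.intervalIntegrable (by fun_prop) _ _))
    (fun c p q => by
      simp only [eval_smul, smul_eq_mul, mul_left_comm _ c, integral_const_mul])

theorem unitIntervalForm_apply (p q : ℝ[X]) :
    unitIntervalForm p q = ∫ t in (0 : ℝ)..1, p.eval t * q.eval t := rfl

theorem eq_zero_of_unitIntervalForm_self_eq_zero {p : ℝ[X]} (h : unitIntervalForm p p = 0) :
    p = 0 := by
  refine eq_zero_of_infinite_isRoot p ((Set.Icc_infinite (zero_lt_one' ℝ)).mono fun x hx => ?_)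
  by_contra hne
  refine (integral_pos zero_lt_one ?_ (fun t _ => mul_self_nonneg (p.eval t))
    ⟨x, hx, mul_self_pos.2 hne⟩).ne' h
  fun_prop

/-- The Durrmeyer operator of degree `n` on real polynomials. -/
noncomputable def durrmeyer (n : ℕ) : ℝ[X] →ₗ[ℝ] ℝ[X] :=
  ∑ i ∈ Finset.range (n + 1),
    (((n : ℝ) + 1) • unitIntervalForm.flip (bernsteinPolynomial ℝ n i)).smulRight
      (bernsteinPolynomial ℝ n i)

theorem durrmeyer_apply (n : ℕ) (p : ℝ[X]) :
    durrmeyer n p = ∑ i ∈ Finset.range (n + 1),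
      (((n : ℝ) + 1) * unitIntervalForm p (bernsteinPolynomial ℝ n i)) •
        bernsteinPolynomial ℝ n i := by
  simp [durrmeyer]

theorem durrmeyer_mem_degreeLT (n : ℕ) (p : ℝ[X]) : durrmeyer n p ∈ degreeLT ℝ (n + 1) := by
  rw [durrmeyer_apply]
  exact Submodule.sum_mem _ fun i hi => Submodule.smul_mem _ _
    (bernsteinPolynomial_mem_degreeLT (Nat.lt_succ_iff.1 (Finset.mem_range.1 hi)))

theorem eq_zero_of_durrmeyer_eq_zero {n : ℕ} {p : ℝ[X]} (hp : p ∈ degreeLT ℝ (n + 1))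
    (h : durrmeyer n p = 0) : p = 0 := by
  rw [durrmeyer_apply, Finset.sum_range] at h
  have hb := Fintype.linearIndependent_iff.1 (linearIndependent_bernsteinPolynomial ℝ n) _ h
  refine eq_zero_of_unitIntervalForm_self_eq_zero ?_
  have hle : degreeLT ℝ (n + 1) ≤ LinearMap.ker (unitIntervalForm p) := by
    rw [← span_bernsteinPolynomial ℝ n, Submodule.span_le]
    rintro _ ⟨i, rfl⟩
    exact (mul_eq_zero.1 (hb i)).resolve_left n.cast_add_one_ne_zero
  exact hle hp

open Polynomial intervalIntegral

/-- **The Durrmeyer operator is an isomorphism of `P_n`.**  For every `n ≥ 0`,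
the linear map `M_n p = Σ_{i=0}^n (n+1) (∫₀¹ p b_i^{(n)}) b_i^{(n)}` maps the
space of real polynomials of degree at most `n` (i.e. of degree `< n+1`)
bijectively onto itself, as a linear isomorphism. -/
theorem durrmeyer_operator_isomorphism (n : ℕ) :
    ∃ e : Polynomial.degreeLT ℝ (n + 1) ≃ₗ[ℝ] Polynomial.degreeLT ℝ (n + 1),
      ∀ p : Polynomial.degreeLT ℝ (n + 1),
        (e p : Polynomial ℝ) =
          ∑ i ∈ Finset.range (n + 1),
            Polynomial.C
                (((n : ℝ) + 1) *
                  ∫ t in (0 : ℝ)..1,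
                    (p : Polynomial ℝ).eval t * (bernsteinPolynomial ℝ n i).eval t) *
              bernsteinPolynomial ℝ n i := by
  have : FiniteDimensional ℝ (degreeLT ℝ (n + 1)) :=
    (degreeLTEquiv ℝ (n + 1)).symm.finiteDimensional
  let f : degreeLT ℝ (n + 1) →ₗ[ℝ] degreeLT ℝ (n + 1) :=
    (durrmeyer n).restrict fun p _ => durrmeyer_mem_degreeLT n p
  have hf : Function.Injective f := (injective_iff_map_eq_zero f).2 fun p hp =>
    Subtype.ext (eq_zero_of_durrmeyer_eq_zero p.2 (congrArg Subtype.val hp))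
  refine ⟨LinearEquiv.ofInjectiveEndo f hf, fun p => ?_⟩
  change durrmeyer n p = _
  simp only [durrmeyer_apply, smul_eq_C_mul, unitIntervalForm_apply]
end

section
/- Let d ≥ 1, let f : ℝ^d → ℝ be twice continuously differentiable, and let x = (x₁,…,x_d) belong to the simplex S = {x ∈ ℝ^d : x_i ≥ 0 for all i, x₁+…+x_d = 1}. Then n·(B_n f(x) − f(x)) converges as n → ∞ to (1/2)·Σ_{1≤i<j≤d} x_i x_j · (∂_i − ∂_j)² f(x), where B_n f(x) = Σ_{i∈ℕ^d, |i|=n} f(i/n)·(n!/i!)·x^i and (∂_i − ∂_j)² f = ∂²f/∂x_i² − 2·∂²f/∂x_i∂x_j + ∂²f/∂x_j². -/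
open Finset Filter

/-- The multivariate Bernstein operator on the simplex (in barycentric
coordinates): `B_n f(x) = Σ_{|i|=n} f(i/n) (n!/i!) xⁱ`. -/
noncomputable def simplexBernstein (d n : ℕ) (f : (Fin d → ℝ) → ℝ) (x : Fin d → ℝ) : ℝ :=
  ∑ i ∈ Finset.Nat.antidiagonalTuple d n,
    f (fun s => (i s : ℝ) / (n : ℝ)) *
      (((n.factorial : ℝ) / ∏ s, ((i s).factorial : ℝ)) * ∏ s, x s ^ i s)

/-- The multinomial probability of the multi-index `i` with `|i| = n` and parameters `x`. -/
noncomputable def multinomialWeight {d : ℕ} (n : ℕ) (x : Fin d → ℝ) (i : Fin d → ℕ) : ℝ :=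
  ((n.factorial : ℝ) / ∏ s, ((i s).factorial : ℝ)) * ∏ s, x s ^ i s

/-- The expectation of `g (i - n x)` for `i` multinomial with parameters `n` and `x`. -/
noncomputable def multinomialMean {d : ℕ} (n : ℕ) (x : Fin d → ℝ) (g : (Fin d → ℝ) → ℝ) : ℝ :=
  ∑ i ∈ Finset.Nat.antidiagonalTuple d n, g (fun s => i s - n * x s) * multinomialWeight n x i

section Multinomial

variable {d : ℕ} {x : Fin d → ℝ}

lemma multinomialWeight_nonneg (hx0 : ∀ s, 0 ≤ x s) (n : ℕ) (i : Fin d → ℕ) :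
    0 ≤ multinomialWeight n x i := by
  unfold multinomialWeight
  have := prod_nonneg fun s (_ : s ∈ univ) => pow_nonneg (hx0 s) (i s)
  positivity

lemma multinomialWeight_add_single (n : ℕ) (x : Fin d → ℝ) (j : Fin d → ℕ) (s : Fin d) :
    (j s + 1 : ℝ) * multinomialWeight (n + 1) x (j + Pi.single s 1) =
      (n + 1) * (x s * multinomialWeight n x j) := by
  have hfac : ∏ t, (((j + Pi.single s 1 : Fin d → ℕ) t).factorial : ℝ) =
      (j s + 1) * ∏ t, ((j t).factorial : ℝ) := by
    have h : ∀ t, (((j + Pi.single s 1 : Fin d → ℕ) t).factorial : ℝ) =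
        (if t = s then (j t + 1 : ℝ) else 1) * (j t).factorial := by
      intro t
      by_cases h : t = s
      · subst h
        simp [Nat.factorial_succ]
      · simp [h]
    simp only [h, prod_mul_distrib]
    simp
  have hpow : ∏ t, x t ^ (j + Pi.single s 1 : Fin d → ℕ) t = x s * ∏ t, x t ^ j t := by
    have h : ∀ t, x t ^ (j + Pi.single s 1 : Fin d → ℕ) t =
        (if t = s then x t else 1) * x t ^ j t := by
      intro t
      by_cases h : t = s
      · subst h
        simp [pow_succ']
      · simp [h]
    simp only [h, prod_mul_distrib]
    simp
  have h1 : (j s + 1 : ℝ) ≠ 0 := by positivity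
  have h2 : ∏ t, ((j t).factorial : ℝ) ≠ 0 :=
    prod_ne_zero_iff.2 fun t _ => by positivity
  unfold multinomialWeight
  rw [hfac, hpow, Nat.factorial_succ]
  push_cast
  field_simp

lemma sum_antidiagonalTuple_succ (n : ℕ) (x : Fin d → ℝ) (g : (Fin d → ℕ) → ℝ) :
    ∑ i ∈ Finset.Nat.antidiagonalTuple d (n + 1), g i * multinomialWeight (n + 1) x i =
      ∑ s, x s * ∑ j ∈ Finset.Nat.antidiagonalTuple d n,
        g (j + Pi.single s 1) * multinomialWeight n x j := by
  have hn : (n + 1 : ℝ) ≠ 0 := by positivity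
  have key : ∀ s, x s * ∑ j ∈ Finset.Nat.antidiagonalTuple d n,
        g (j + Pi.single s 1) * multinomialWeight n x j =
      ∑ i ∈ Finset.Nat.antidiagonalTuple d (n + 1),
        (i s : ℝ) / (n + 1) * (g i * multinomialWeight (n + 1) x i) := by
    intro s
    rw [mul_sum]
    refine sum_of_injOn (fun j => j + Pi.single s 1) (add_left_injective _).injOn ?_ ?_ ?_
    · intro j hj
      simp only [mem_coe, Finset.Nat.mem_antidiagonalTuple] at hj ⊢
      simp [sum_add_distrib, hj]
    · intro i hi hni
      have : i s = 0 := by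
        by_contra h
        refine hni ⟨i - Pi.single s 1, ?_, ?_⟩
        · have hle : Pi.single s 1 ≤ i := by
            intro t
            by_cases ht : t = s
            · subst ht
              simp
              omega
            · simp [ht]
          have h2 := congrArg (fun f : Fin d → ℕ => ∑ t, f t) (tsub_add_cancel_of_le hle)
          simp only [Pi.add_apply, sum_add_distrib, Finset.Nat.mem_antidiagonalTuple.1 hi,
            sum_pi_single', mem_univ, if_true] at h2
          simp only [mem_coe, Finset.Nat.mem_antidiagonalTuple]
          omega
        · funext t
          by_cases ht : t = s
          · subst ht
            simp
            omega
          · simp [ht]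
      simp [this]
    · intro j _
      have := multinomialWeight_add_single n x j s
      simp only [Pi.add_apply, Pi.single_eq_same]
      push_cast
      field_simp
      linear_combination (-g (j + Pi.single s 1)) * this
  simp only [key]
  rw [sum_comm]
  refine sum_congr rfl fun i hi => ?_
  have h : ∑ s, (i s : ℝ) = n + 1 := by
    exact_mod_cast Finset.Nat.mem_antidiagonalTuple.1 hi
  rw [← sum_mul, ← sum_div, h, div_self hn, one_mul]

lemma multinomialMean_succ (n : ℕ) (x : Fin d → ℝ) (g : (Fin d → ℝ) → ℝ) :
    multinomialMean (n + 1) x g =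
      ∑ s, x s * multinomialMean n x fun z => g (z + (Pi.single s 1 - x)) := by
  unfold multinomialMean
  rw [sum_antidiagonalTuple_succ n x fun i => g fun s => i s - (n + 1 : ℕ) * x s]
  refine sum_congr rfl fun s _ => ?_
  congr 1
  refine sum_congr rfl fun j _ => ?_
  congr 2
  funext t
  by_cases ht : t = s
  · subst ht
    simp
    ring
  · simp [ht]
    ring

lemma multinomialMean_zero (x : Fin d → ℝ) (g : (Fin d → ℝ) → ℝ) :
    multinomialMean 0 x g = g 0 := by
  simp [multinomialMean, multinomialWeight, Finset.Nat.antidiagonalTuple_zero_right]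
  rfl

lemma multinomialMean_add (n : ℕ) (x : Fin d → ℝ) (g h : (Fin d → ℝ) → ℝ) :
    multinomialMean n x (fun z => g z + h z) = multinomialMean n x g + multinomialMean n x h := by
  simp only [multinomialMean, add_mul, sum_add_distrib]

lemma multinomialMean_const_mul (n : ℕ) (x : Fin d → ℝ) (c : ℝ) (g : (Fin d → ℝ) → ℝ) :
    multinomialMean n x (fun z => c * g z) = c * multinomialMean n x g := by
  simp only [multinomialMean, mul_assoc, mul_sum]

lemma multinomialMean_sum {ι : Type*} (t : Finset ι) (n : ℕ) (x : Fin d → ℝ)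
    (g : ι → (Fin d → ℝ) → ℝ) :
    multinomialMean n x (fun z => ∑ k ∈ t, g k z) = ∑ k ∈ t, multinomialMean n x (g k) := by
  simp only [multinomialMean, sum_mul]
  exact sum_comm

lemma multinomialMean_const (hx1 : ∑ s, x s = 1) (n : ℕ) (c : ℝ) :
    multinomialMean n x (fun _ => c) = c := by
  induction n with
  | zero => rw [multinomialMean_zero]
  | succ n ih => simp only [multinomialMean_succ, ih, ← sum_mul, hx1, one_mul]

lemma sum_smul_single_sub (hx1 : ∑ s, x s = 1) :
    ∑ s, x s • (Pi.single s 1 - x : Fin d → ℝ) = 0 := by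
  simp only [smul_sub, sum_sub_distrib, ← sum_smul, hx1, one_smul]
  rw [sub_eq_zero]
  funext t
  simp [Finset.sum_apply, Pi.single_apply]

lemma sum_mul_map_single_sub (hx1 : ∑ s, x s = 1) (ℓ : (Fin d → ℝ) →L[ℝ] ℝ) :
    ∑ s, x s * ℓ (Pi.single s 1 - x) = 0 := by
  simpa using congrArg ℓ (sum_smul_single_sub hx1)

lemma multinomialMean_linear (hx1 : ∑ s, x s = 1) (n : ℕ) (ℓ : (Fin d → ℝ) →L[ℝ] ℝ) :
    multinomialMean n x (fun z => ℓ z) = 0 := by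
  induction n with
  | zero => simp [multinomialMean_zero]
  | succ n ih =>
    simp only [multinomialMean_succ, map_add ℓ, multinomialMean_add, ih,
      multinomialMean_const hx1, zero_add, sum_mul_map_single_sub hx1]

lemma multinomialMean_bilinear (hx1 : ∑ s, x s = 1) (n : ℕ)
    (B : (Fin d → ℝ) →L[ℝ] (Fin d → ℝ) →L[ℝ] ℝ) :
    multinomialMean n x (fun z => B z z) =
      n * ∑ s, x s * B (Pi.single s 1 - x) (Pi.single s 1 - x) := by
  induction n with
  | zero => simp [multinomialMean_zero]
  | succ n ih =>
    have hs : ∀ v, multinomialMean n x (fun z => B (z + v) (z + v)) =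
        multinomialMean n x (fun z => B z z) + B v v := by
      intro v
      have h : ∀ z, B (z + v) (z + v) = B z z + ((B.flip v + B v) z + B v v) := by
        intro z
        simp
        ring
      simp only [h]
      rw [multinomialMean_add, multinomialMean_add, multinomialMean_linear hx1,
        multinomialMean_const hx1, zero_add]
    simp only [multinomialMean_succ, hs, ih, mul_add, sum_add_distrib, ← sum_mul, hx1]
    push_cast
    ring

lemma multinomialMean_sq (hx1 : ∑ s, x s = 1) (n : ℕ) (ℓ : (Fin d → ℝ) →L[ℝ] ℝ) :
    multinomialMean n x (fun z => ℓ z ^ 2) =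
      n * ∑ s, x s * ℓ (Pi.single s 1 - x) ^ 2 := by
  simpa [sq] using multinomialMean_bilinear hx1 n (ℓ.smulRight ℓ)

lemma multinomialMean_cube (hx1 : ∑ s, x s = 1) (n : ℕ) (ℓ : (Fin d → ℝ) →L[ℝ] ℝ) :
    multinomialMean n x (fun z => ℓ z ^ 3) =
      n * ∑ s, x s * ℓ (Pi.single s 1 - x) ^ 3 := by
  induction n with
  | zero => simp [multinomialMean_zero]
  | succ n ih =>
    have hs : ∀ c, multinomialMean n x (fun z => (ℓ z + c) ^ 3) =
        multinomialMean n x (fun z => ℓ z ^ 3) +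
          (c * (3 * multinomialMean n x (fun z => ℓ z ^ 2)) + c ^ 3) := by
      intro c
      have h : ∀ z, (ℓ z + c) ^ 3 =
          ℓ z ^ 3 + (3 * c * ℓ z ^ 2 + (3 * c ^ 2 * ℓ z + c ^ 3)) := fun z => by ring
      simp only [h]
      rw [multinomialMean_add, multinomialMean_add, multinomialMean_add,
        multinomialMean_const_mul, multinomialMean_const_mul, multinomialMean_linear hx1,
        multinomialMean_const hx1]
      ring
    simp only [multinomialMean_succ, map_add ℓ, hs, ih, mul_add, sum_add_distrib, ← sum_mul, hx1,
      ← mul_assoc, sum_mul_map_single_sub hx1]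
    push_cast
    ring

lemma multinomialMean_fourth (hx1 : ∑ s, x s = 1) (n : ℕ) (ℓ : (Fin d → ℝ) →L[ℝ] ℝ) :
    multinomialMean n x (fun z => ℓ z ^ 4) =
      n * ∑ s, x s * ℓ (Pi.single s 1 - x) ^ 4 +
        3 * n * (n - 1) * (∑ s, x s * ℓ (Pi.single s 1 - x) ^ 2) ^ 2 := by
  induction n with
  | zero => simp [multinomialMean_zero]
  | succ n ih =>
    have hs : ∀ c, multinomialMean n x (fun z => (ℓ z + c) ^ 4) =
        multinomialMean n x (fun z => ℓ z ^ 4) +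
          (c * (4 * multinomialMean n x (fun z => ℓ z ^ 3)) +
          (c ^ 2 * (6 * multinomialMean n x (fun z => ℓ z ^ 2)) + c ^ 4)) := by
      intro c
      have h : ∀ z, (ℓ z + c) ^ 4 =
          ℓ z ^ 4 + (4 * c * ℓ z ^ 3 + (6 * c ^ 2 * ℓ z ^ 2 + (4 * c ^ 3 * ℓ z + c ^ 4))) :=
        fun z => by ring
      simp only [h]
      rw [multinomialMean_add, multinomialMean_add, multinomialMean_add, multinomialMean_add,
        multinomialMean_const_mul, multinomialMean_const_mul, multinomialMean_const_mul,
        multinomialMean_linear hx1, multinomialMean_const hx1]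
      ring
    simp only [multinomialMean_succ, map_add ℓ, hs, ih, multinomialMean_sq hx1, mul_add,
      sum_add_distrib]
    simp only [← mul_assoc, ← sum_mul, hx1, sum_mul_map_single_sub hx1]
    push_cast
    ring

/-- The covariance form of a single multinomial draw, written as a sum over pairs. -/
lemma sum_mul_bilinear_single_sub (hx1 : ∑ s, x s = 1)
    (B : (Fin d → ℝ) →L[ℝ] (Fin d → ℝ) →L[ℝ] ℝ) :
    ∑ s, x s * B (Pi.single s 1 - x) (Pi.single s 1 - x) =
      ∑ p ∈ univ.filter (fun p : Fin d × Fin d => p.1 < p.2),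
        x p.1 * x p.2 * B (Pi.single p.1 1 - Pi.single p.2 1)
          (Pi.single p.1 1 - Pi.single p.2 1) := by
  set G : Fin d × Fin d → ℝ := fun p => x p.1 * x p.2 *
    B (Pi.single p.1 1 - Pi.single p.2 1) (Pi.single p.1 1 - Pi.single p.2 1) with hG
  set ξ : Fin d → Fin d → ℝ := fun s => Pi.single s 1 - x with hξ
  set c := ∑ s, x s * B (ξ s) (ξ s) with hc
  have hGξ : ∀ s t, G (s, t) = x s * x t * B (ξ s) (ξ s) + x s * x t * B (ξ t) (ξ t)
      - x s * (x t * B (ξ s) (ξ t)) - x s * (x t * B.flip (ξ s) (ξ t)) := by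
    intro s t
    have : (Pi.single s 1 - Pi.single t 1 : Fin d → ℝ) = ξ s - ξ t := by simp [hξ]
    simp only [hG]
    rw [this]
    simp only [map_sub, sub_apply, ContinuousLinearMap.flip_apply]
    ring
  have hall : ∑ p, G p = 2 * c := by
    rw [Fintype.sum_prod_type]
    have : ∀ s, ∑ t, G (s, t) = x s * B (ξ s) (ξ s) + x s * c := by
      intro s
      simp only [hGξ, sum_sub_distrib, sum_add_distrib, ← mul_sum]
      rw [sum_mul_map_single_sub hx1, sum_mul_map_single_sub hx1, ← sum_mul, ← mul_sum, hx1, hc]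
      simp only [mul_assoc, ← mul_sum]
      ring
    simp only [this, sum_add_distrib, ← sum_mul, hx1]
    ring
  have hgt : ∑ p ∈ univ.filter (fun p : Fin d × Fin d => ¬ p.1 < p.2), G p =
      ∑ p ∈ univ.filter (fun p : Fin d × Fin d => p.1 < p.2), G p := by
    symm
    refine sum_of_injOn Prod.swap Prod.swap_injective.injOn ?_ ?_ ?_
    · intro p hp
      simp at hp ⊢
      exact hp.le
    · intro p hp hnp
      have : p.1 = p.2 := by
        by_contra h
        refine hnp ⟨p.swap, ?_, by simp⟩
        simp at hp ⊢
        exact lt_of_le_of_ne hp (Ne.symm h)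
      simp [hG, this]
    · intro p _
      have : (Pi.single p.2 1 - Pi.single p.1 1 : Fin d → ℝ) =
          -(Pi.single p.1 1 - Pi.single p.2 1) := by abel
      simp only [hG, Prod.fst_swap, Prod.snd_swap, this, map_neg, neg_apply]
      ring
  have hsplit := sum_filter_add_sum_filter_not univ (fun p : Fin d × Fin d => p.1 < p.2) G
  linarith

lemma abs_multinomialMean_le (hx0 : ∀ s, 0 ≤ x s) (n : ℕ) {g h : (Fin d → ℝ) → ℝ}
    (hgh : ∀ i ∈ Finset.Nat.antidiagonalTuple d n,
      |g fun s => i s - n * x s| ≤ h fun s => i s - n * x s) :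
    |multinomialMean n x g| ≤ multinomialMean n x h := by
  refine (abs_sum_le_sum_abs _ _).trans (sum_le_sum fun i hi => ?_)
  rw [abs_mul, abs_of_nonneg (multinomialWeight_nonneg hx0 n i)]
  exact mul_le_mul_of_nonneg_right (hgh i hi) (multinomialWeight_nonneg hx0 n i)

end Multinomial

section Taylor

variable {E : Type*} [NormedAddCommGroup E] [NormedSpace ℝ E]

/-- Second-order Taylor expansion with Peano remainder. -/
lemma ContDiff.taylor_two_isLittleO {f : E → ℝ} (hf : ContDiff ℝ 2 f) (x : E) :
    (fun v => f (x + v) - f x - fderiv ℝ f x v - 1 / 2 * fderiv ℝ (fderiv ℝ f) x v v)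
      =o[nhds 0] fun v => ‖v‖ ^ 2 := by
  set B := fderiv ℝ (fderiv ℝ f) x with hB
  have hsymm : ∀ v w, B v w = B w v :=
    hf.contDiffAt.isSymmSndFDerivAt (by simp)
  have hd : Differentiable ℝ f := hf.differentiable (by norm_num)
  have hd' : Differentiable ℝ (fderiv ℝ f) :=
    (hf.fderiv_right (m := 1) (by norm_num)).differentiable (by norm_num)
  have hderiv : ∀ v, HasFDerivAt
      (fun v => f (x + v) - f x - fderiv ℝ f x v - 1 / 2 * B v v)
      (fderiv ℝ f (x + v) - fderiv ℝ f x - B v) v := by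
    intro v
    have h1 : HasFDerivAt (fun v => f (x + v)) (fderiv ℝ f (x + v)) v :=
      (hasFDerivAt_comp_add_left x).2 (hd (x + v)).hasFDerivAt
    have h2 := (B.hasFDerivAt (x := v)).clm_apply (hasFDerivAt_id v)
    refine (((h1.sub_const (f x)).sub (fderiv ℝ f x).hasFDerivAt).sub
      (h2.const_mul (1 / 2))).congr_fderiv ?_
    ext w
    simp [hsymm w v]
    ring
  have hlo : (fun v => fderiv ℝ f (x + v) - fderiv ℝ f x - B v) =o[nhdsWithin 0 Set.univ]
      fun v => ‖v - 0‖ ^ 1 := by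
    have := (hasFDerivAt_iff_isLittleO_nhds_zero.1 (hd' x).hasFDerivAt)
    simpa [nhdsWithin_univ] using this.norm_right
  have := convex_univ.isLittleO_pow_succ (Set.mem_univ 0)
    (fun v _ => (hderiv v).hasFDerivWithinAt) hlo
  simpa [nhdsWithin_univ] using this

/-- The second-order Taylor remainder is at most `ε ‖v‖ ^ 2 + C ‖v‖ ^ 4` on the unit ball. -/
lemma ContDiff.exists_abs_taylor_two_le [FiniteDimensional ℝ E] {f : E → ℝ}
    (hf : ContDiff ℝ 2 f) (x : E) {ε : ℝ} (hε : 0 < ε) :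
    ∃ C, 0 ≤ C ∧ ∀ v, ‖v‖ ≤ 1 →
      |f (x + v) - f x - fderiv ℝ f x v - 1 / 2 * fderiv ℝ (fderiv ℝ f) x v v| ≤
        ε * ‖v‖ ^ 2 + C * ‖v‖ ^ 4 := by
  obtain ⟨δ, hδ, hnear⟩ := Metric.eventually_nhds_iff.1
    ((Asymptotics.isLittleO_iff.1 (hf.taylor_two_isLittleO x)) hε)
  have hcont : Continuous fun v =>
      f (x + v) - f x - fderiv ℝ f x v - 1 / 2 * fderiv ℝ (fderiv ℝ f) x v v := by
    have := hf.continuous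
    fun_prop
  have : ProperSpace E := FiniteDimensional.proper ℝ E
  obtain ⟨M, hM⟩ := (isCompact_closedBall (0 : E) 1).exists_bound_of_continuousOn
    hcont.continuousOn
  refine ⟨|M| / δ ^ 4, by positivity, fun v hv => ?_⟩
  rcases lt_or_ge ‖v‖ δ with h | h
  · have := hnear (y := v) (by simpa using h)
    simp only [Real.norm_eq_abs, abs_pow, abs_norm] at this
    have h2 : 0 ≤ |M| / δ ^ 4 * ‖v‖ ^ 4 := by positivity
    linarith
  · have := hM v (by simpa using hv)
    rw [Real.norm_eq_abs] at this
    have h2 : |M| ≤ |M| / δ ^ 4 * ‖v‖ ^ 4 := by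
      rw [div_mul_eq_mul_div, le_div_iff₀ (by positivity)]
      gcongr
    have h3 : 0 ≤ ε * ‖v‖ ^ 2 := by positivity
    linarith [le_abs_self M]

end Taylor

lemma norm_pow_le_sum_abs_pow {d : ℕ} (z : Fin d → ℝ) {k : ℕ} (hk : k ≠ 0) :
    ‖z‖ ^ k ≤ ∑ s, |z s| ^ k := by
  have hnn : ∀ s ∈ univ, 0 ≤ |z s| ^ k := fun s _ => by positivity
  rcases isEmpty_or_nonempty (Fin d) with h | h
  · simp [Subsingleton.elim z 0, hk]
  · obtain ⟨s, hs⟩ := Finite.exists_max fun s => ‖z s‖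
    calc ‖z‖ ^ k ≤ |z s| ^ k := by
          gcongr
          exact (pi_norm_le_iff_of_nonempty z).2 hs
      _ ≤ ∑ s, |z s| ^ k := single_le_sum hnn (mem_univ s)

lemma norm_inv_smul_le_one {d n : ℕ} (hn : n ≠ 0) {x : Fin d → ℝ} (hx0 : ∀ s, 0 ≤ x s)
    (hx1 : ∑ s, x s = 1) {i : Fin d → ℕ} (hi : i ∈ Finset.Nat.antidiagonalTuple d n) :
    ‖(n : ℝ)⁻¹ • (fun s => i s - n * x s : Fin d → ℝ)‖ ≤ 1 := by
  have hn' : (0 : ℝ) < n := by positivity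
  refine (pi_norm_le_iff_of_nonneg zero_le_one).2 fun s => ?_
  have h1 : i s ≤ n := by
    rw [← Finset.Nat.mem_antidiagonalTuple.1 hi]
    exact single_le_sum (fun _ _ => Nat.zero_le _) (mem_univ s)
  have h1' : (i s : ℝ) / n ≤ 1 := (div_le_one hn').2 (by exact_mod_cast h1)
  have h2 : x s ≤ 1 := hx1 ▸ single_le_sum (fun t _ => hx0 t) (mem_univ s)
  have h3 : (0 : ℝ) ≤ i s / n := by positivity
  have h : ((n : ℝ)⁻¹ • (fun s => i s - n * x s : Fin d → ℝ)) s = i s / n - x s := by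
    simp only [Pi.smul_apply, smul_eq_mul]
    field_simp
  rw [h, Real.norm_eq_abs, abs_le]
  constructor <;> linarith [hx0 s]

lemma simplexBernstein_eq_multinomialMean {d n : ℕ} (hn : n ≠ 0) (f : (Fin d → ℝ) → ℝ)
    (x : Fin d → ℝ) :
    simplexBernstein d n f x = multinomialMean n x fun z => f (x + (n : ℝ)⁻¹ • z) := by
  have hn' : (n : ℝ) ≠ 0 := by exact_mod_cast hn
  refine sum_congr rfl fun i _ => ?_
  rw [multinomialWeight]
  congr 2
  funext s
  simp only [Pi.add_apply, Pi.smul_apply, smul_eq_mul]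
  field_simp
  ring

/-- Second and fourth central moments of the multinomial distribution in the supremum norm. -/
lemma exists_multinomialMean_norm_pow_le {d : ℕ} {x : Fin d → ℝ} (hx0 : ∀ s, 0 ≤ x s)
    (hx1 : ∑ s, x s = 1) :
    ∃ K, 0 ≤ K ∧ ∀ n : ℕ, multinomialMean n x (fun z => ‖z‖ ^ 2) ≤ K * n ∧
      multinomialMean n x (fun z => ‖z‖ ^ 4) ≤ K * n ^ 2 := by
  let ℓ : Fin d → (Fin d → ℝ) →L[ℝ] ℝ := fun t => ContinuousLinearMap.proj t
  let σ : ℕ → Fin d → ℝ := fun k t => ∑ s, x s * |ℓ t (Pi.single s 1 - x)| ^ k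
  have hσ : ∀ k t, 0 ≤ σ k t := fun k t =>
    sum_nonneg fun s _ => mul_nonneg (hx0 s) (by positivity)
  have hle : ∀ n k, k ≠ 0 → multinomialMean n x (fun z => ‖z‖ ^ k) ≤
      ∑ t, multinomialMean n x (fun z => |ℓ t z| ^ k) := by
    intro n k hk
    rw [← multinomialMean_sum]
    refine (le_abs_self _).trans (abs_multinomialMean_le hx0 n fun i _ => ?_)
    rw [abs_of_nonneg (by positivity)]
    exact norm_pow_le_sum_abs_pow _ hk
  have h4 : ∀ a : ℝ, |a| ^ 4 = a ^ 4 := (even_two_mul 2).pow_abs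
  refine ⟨∑ t, (σ 2 t + σ 4 t + 3 * σ 2 t ^ 2), sum_nonneg fun t _ => ?_,
    fun n => ⟨(hle n 2 (by norm_num)).trans ?_, (hle n 4 (by norm_num)).trans ?_⟩⟩
  · have := hσ 2 t
    have := hσ 4 t
    positivity
  · rw [sum_mul]
    refine sum_le_sum fun t _ => ?_
    have h : multinomialMean n x (fun z => |ℓ t z| ^ 2) = n * σ 2 t := by
      simp only [σ, sq_abs]
      exact multinomialMean_sq hx1 n (ℓ t)
    rw [h, mul_comm]
    have := hσ 4 t
    gcongr
    nlinarith [sq_nonneg (σ 2 t)]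
  · rw [sum_mul]
    refine sum_le_sum fun t _ => ?_
    have h : multinomialMean n x (fun z => |ℓ t z| ^ 4) =
        n * σ 4 t + 3 * n * (n - 1) * σ 2 t ^ 2 := by
      simp only [σ, h4, sq_abs]
      exact multinomialMean_fourth hx1 n (ℓ t)
    rw [h]
    have h0 : (0 : ℝ) ≤ n := n.cast_nonneg
    have hn : (n : ℝ) ≤ n ^ 2 := by exact_mod_cast Nat.le_self_pow (by norm_num) n
    nlinarith [mul_nonneg (hσ 4 t) (sub_nonneg.2 hn), mul_nonneg h0 (sq_nonneg (σ 2 t)),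
      mul_nonneg (hσ 2 t) (sq_nonneg (n : ℝ))]

/-- **Voronovskaja-type theorem for the Bernstein operator on the simplex.**
If `f : ℝ^d → ℝ` is twice continuously differentiable and `x` lies in the
simplex `{x : x_i ≥ 0, Σ x_i = 1}`, then
`n (B_n f(x) − f(x)) → (1/2) Σ_{i<j} x_i x_j (∂_i − ∂_j)² f(x)` as `n → ∞`,
where `(∂_i − ∂_j)² f(x)` is the second derivative of `f` at `x` along the
direction `e_i − e_j`. -/
theorem simplex_bernstein_voronovskaja (d : ℕ) (hd : 1 ≤ d)
    (f : (Fin d → ℝ) → ℝ) (hf : ContDiff ℝ 2 f)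
    (x : Fin d → ℝ) (hx0 : ∀ s, 0 ≤ x s) (hx1 : ∑ s, x s = 1) :
    Tendsto (fun n : ℕ => (n : ℝ) * (simplexBernstein d n f x - f x)) atTop
      (nhds ((1 / 2 : ℝ) *
        ∑ p ∈ Finset.univ.filter (fun p : Fin d × Fin d => p.1 < p.2),
          x p.1 * x p.2 *
            iteratedFDeriv ℝ 2 f x
              ![(Pi.single p.1 1 - Pi.single p.2 1 : Fin d → ℝ),
                (Pi.single p.1 1 - Pi.single p.2 1 : Fin d → ℝ)])) := by
  set B := fderiv ℝ (fderiv ℝ f) x with hB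
  set ℓ := fderiv ℝ f x with hℓ
  have hlim : ∑ p ∈ Finset.univ.filter (fun p : Fin d × Fin d => p.1 < p.2),
      x p.1 * x p.2 * iteratedFDeriv ℝ 2 f x
        ![(Pi.single p.1 1 - Pi.single p.2 1 : Fin d → ℝ),
          (Pi.single p.1 1 - Pi.single p.2 1 : Fin d → ℝ)] =
      ∑ s, x s * B (Pi.single s 1 - x) (Pi.single s 1 - x) := by
    rw [sum_mul_bilinear_single_sub hx1]
    simp [iteratedFDeriv_two_apply, hB]
  rw [hlim]
  set c := ∑ s, x s * B (Pi.single s 1 - x) (Pi.single s 1 - x) with hc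
  set R : (Fin d → ℝ) → ℝ := fun v => f (x + v) - f x - ℓ v - 1 / 2 * B v v with hR
  have hmean : ∀ n : ℕ, n ≠ 0 → (n : ℝ) * (simplexBernstein d n f x - f x) - 1 / 2 * c =
      n * multinomialMean n x fun z => R ((n : ℝ)⁻¹ • z) := by
    intro n hn
    have hn' : (n : ℝ) ≠ 0 := by exact_mod_cast hn
    have h : ∀ z, f (x + (n : ℝ)⁻¹ • z) = R ((n : ℝ)⁻¹ • z) +
        (f x + ((n : ℝ)⁻¹ * ℓ z + 1 / 2 * (n : ℝ)⁻¹ ^ 2 * B z z)) := by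
      intro z
      simp only [hR, map_smul, smul_eq_mul, smul_apply]
      ring
    rw [simplexBernstein_eq_multinomialMean hn]
    simp only [h]
    rw [multinomialMean_add, multinomialMean_add, multinomialMean_add,
      multinomialMean_const hx1, multinomialMean_const_mul, multinomialMean_const_mul,
      multinomialMean_linear hx1, multinomialMean_bilinear hx1]
    field_simp
    ring
  obtain ⟨K, hK, hmom⟩ := exists_multinomialMean_norm_pow_le hx0 hx1
  rw [Metric.tendsto_atTop]
  intro η hη
  obtain ⟨C, hC, hrem⟩ := hf.exists_abs_taylor_two_le x (ε := η / (2 * (K + 1))) (by positivity)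
  obtain ⟨N, hN⟩ := exists_nat_gt (2 * (C * K) / η)
  refine ⟨N + 1, fun n hn => ?_⟩
  have hn0 : n ≠ 0 := by omega
  have hn' : (0 : ℝ) < n := by positivity
  have hbound : |multinomialMean n x fun z => R ((n : ℝ)⁻¹ • z)| ≤
      η / (2 * (K + 1)) * (n : ℝ)⁻¹ ^ 2 * (K * n) + C * (n : ℝ)⁻¹ ^ 4 * (K * n ^ 2) := by
    have h := abs_multinomialMean_le hx0 n (g := fun z => R ((n : ℝ)⁻¹ • z))
      (h := fun z => η / (2 * (K + 1)) * (n : ℝ)⁻¹ ^ 2 * ‖z‖ ^ 2 +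
        C * (n : ℝ)⁻¹ ^ 4 * ‖z‖ ^ 4) ?_
    · rw [multinomialMean_add, multinomialMean_const_mul, multinomialMean_const_mul] at h
      refine h.trans ?_
      gcongr
      · exact (hmom n).1
      · exact (hmom n).2
    · intro i hi
      refine (hrem _ (norm_inv_smul_le_one hn0 hx0 hx1 hi)).trans_eq ?_
      rw [norm_smul, Real.norm_of_nonneg (by positivity)]
      ring
  rw [Real.dist_eq, hmean n hn0, abs_mul, abs_of_pos hn']
  have hNn : 2 * (C * K) / η < n := hN.trans (by exact_mod_cast hn)
  have h1 : C * K / n < η / 2 := by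
    rw [div_lt_iff₀ hη] at hNn
    rw [div_lt_iff₀ hn']
    linarith
  have h2 : η / (2 * (K + 1)) * K ≤ η / 2 := by
    rw [div_mul_eq_mul_div, div_le_div_iff₀ (by positivity) (by positivity)]
    nlinarith
  calc (n : ℝ) * |multinomialMean n x fun z => R ((n : ℝ)⁻¹ • z)|
      ≤ n * (η / (2 * (K + 1)) * (n : ℝ)⁻¹ ^ 2 * (K * n) +
          C * (n : ℝ)⁻¹ ^ 4 * (K * n ^ 2)) := by gcongr
    _ = η / (2 * (K + 1)) * K + C * K / n := by field_simp
    _ < η := by linarith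
end
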